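/- arXiv:2004.07128 — 2 statements merged into one kernel-verified Lean document; each statement's English description precedes it below -/
import Mathlib

section
/- For the ECA rule 128, with local rule h(a,b,c) = a ∧ b ∧ c, and for every n > 6: the number of distinct asynchronous global functions, i.e. the cardinality of { f^{(τ)} : τ a block-sequential update schedule on ℤ/nℤ }, equals 3^n − 2^{n+1} − 10n + 2. -/
/-- One round of a block-sequential update: all cells of rank `k` are updated
simultaneously by the ECA local rule `h`, reading the current states. -/
def ecaStep (n : ℕ) (h : Bool → Bool → Bool → Bool) (τ : ZMod n → ℕ) (k : ℕ)
    (x : ZMod n → Bool) : ZMod n → Bool :=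
  fun i => if τ i = k then h (x (i - 1)) (x i) (x (i + 1)) else x i

/-- State after processing ranks `0, 1, …, k` in increasing order. -/
def ecaUpTo (n : ℕ) (h : Bool → Bool → Bool → Bool) (τ : ZMod n → ℕ) :
    ℕ → (ZMod n → Bool) → ZMod n → Bool
  | 0 => ecaStep n h τ 0
  | k + 1 => fun x => ecaStep n h τ (k + 1) (ecaUpTo n h τ k x)

/-- Asynchronous global function `f^{(τ)}` for the block-sequential update
schedule `τ : ZMod n → ℕ` (rank of each cell): a cell keeps the value it gets
in the round where it is updated (it is never updated again afterwards). -/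
def ecaAsync (n : ℕ) (h : Bool → Bool → Bool → Bool) (τ : ZMod n → ℕ)
    (x : ZMod n → Bool) : ZMod n → Bool :=
  fun i => ecaUpTo n h τ (τ i) x i

/-- Synchronous global function of the ECA with local rule `h`. -/
def ecaSync (n : ℕ) (h : Bool → Bool → Bool → Bool) (x : ZMod n → Bool) :
    ZMod n → Bool :=
  fun i => h (x (i - 1)) (x i) (x (i + 1))

/-- Label of the arc `(i, j)` for schedule `τ`:
`true` = ⊕ (τ i ≥ τ j), `false` = ⊖ (τ i < τ j). -/
def lab (n : ℕ) (τ : ZMod n → ℕ) (i j : ZMod n) : Bool :=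
  decide (τ j ≤ τ i)

namespace R128

open Classical in
noncomputable def P (n : ℕ) (e : ZMod n → SignType) (i : ZMod n) : ℕ :=
  Nat.findGreatest (fun m => ∀ s < m, e (i - 1 - (s : ZMod n)) = 1) n

open Classical in
noncomputable def Q (n : ℕ) (e : ZMod n → SignType) (i : ZMod n) : ℕ :=
  Nat.findGreatest (fun m => ∀ s < m, e (i + (s : ZMod n)) = -1) n

def Acyc (n : ℕ) (e : ZMod n → SignType) : Prop :=
  (∀ i, e i = 0) ∨ ((∃ i, e i = 1) ∧ (∃ i, e i = -1))

def Eqv (n : ℕ) (e e' : ZMod n → SignType) : Prop :=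
  ∀ i, (P n e i = P n e' i ∧ Q n e i = Q n e' i) ∨
    (n ≤ P n e i + Q n e i + 3 ∧ n ≤ P n e' i + Q n e' i + 3)

def mir (n : ℕ) (e : ZMod n → SignType) : ZMod n → SignType := fun i => - e (-1 - i)

def BadR (n : ℕ) (e : ZMod n → SignType) (j : ZMod n) : Prop :=
  e j = -1 ∧ (∀ t < n - 3, e (j - 1 - (t : ZMod n)) = 1) ∧ (e (j + 1) = -1 ∨ e (j + 2) = -1)

def Bad (n : ℕ) (e : ZMod n → SignType) : Prop :=
  (∃ j, BadR n e j) ∨ (∃ j, BadR n (mir n e) j)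

open Classical in
noncomputable def phi (n : ℕ) (e : ZMod n → SignType) (x : ZMod n → Bool) (i : ZMod n) : Bool :=
  decide ((∀ t ≤ P n e i + 1, x (i - (t : ZMod n)) = true) ∧
    (∀ t ≤ Q n e i + 1, x (i + (t : ZMod n)) = true))

lemma P_spec {n : ℕ} {e : ZMod n → SignType} {i : ZMod n} {t : ℕ} (h : t < P n e i) :
    e (i - 1 - (t : ZMod n)) = 1 := by
  classical
  have := Nat.findGreatest_spec (P := fun m => ∀ s < m, e (i - 1 - (s : ZMod n)) = 1)
    (Nat.zero_le n) (by simp)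
  exact this t (by unfold P at h; convert h)

lemma Q_spec {n : ℕ} {e : ZMod n → SignType} {i : ZMod n} {t : ℕ} (h : t < Q n e i) :
    e (i + (t : ZMod n)) = -1 := by
  classical
  have := Nat.findGreatest_spec (P := fun m => ∀ s < m, e (i + (s : ZMod n)) = -1)
    (Nat.zero_le n) (by simp)
  exact this t (by unfold Q at h; convert h)

lemma le_P {n : ℕ} {e : ZMod n → SignType} {i : ZMod n} {m : ℕ} (hm : m ≤ n)
    (h : ∀ s < m, e (i - 1 - (s : ZMod n)) = 1) : m ≤ P n e i := by
  classical
  exact Nat.le_findGreatest hm h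

lemma le_Q {n : ℕ} {e : ZMod n → SignType} {i : ZMod n} {m : ℕ} (hm : m ≤ n)
    (h : ∀ s < m, e (i + (s : ZMod n)) = -1) : m ≤ Q n e i := by
  classical
  exact Nat.le_findGreatest hm h

lemma P_le {n : ℕ} (e : ZMod n → SignType) (i : ZMod n) : P n e i ≤ n := by
  classical
  exact Nat.findGreatest_le n

lemma Q_le {n : ℕ} (e : ZMod n → SignType) (i : ZMod n) : Q n e i ≤ n := by
  classical
  exact Nat.findGreatest_le n

lemma mir_mir (n : ℕ) (e : ZMod n → SignType) : mir n (mir n e) = e := by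
  funext i; simp [mir]

lemma P_mir (n : ℕ) (e : ZMod n → SignType) (i : ZMod n) : P n (mir n e) i = Q n e (-i) := by
  have key : ∀ s : ZMod n, (mir n e (i - 1 - s) = 1 ↔ e (-i + s) = -1) := by
    intro s
    have : (-1 - (i - 1 - s)) = -i + s := by ring
    simp only [mir, this, neg_eq_iff_eq_neg]
  simp only [P, Q, key]

lemma Q_mir (n : ℕ) (e : ZMod n → SignType) (i : ZMod n) : Q n (mir n e) i = P n e (-i) := by
  have := P_mir n (mir n e) (-i)
  rw [mir_mir, neg_neg] at this
  exact this.symm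

lemma Acyc_mir {n : ℕ} {e : ZMod n → SignType} (h : Acyc n e) : Acyc n (mir n e) := by
  rcases h with h | ⟨⟨a, ha⟩, ⟨b, hb⟩⟩
  · left; intro i; simp [mir, h]
  · right
    exact ⟨⟨-1 - b, by simp [mir, hb]⟩, ⟨-1 - a, by simp [mir, ha]⟩⟩

lemma Eqv_mir {n : ℕ} {e e' : ZMod n → SignType} (h : Eqv n e e') :
    Eqv n (mir n e) (mir n e') := by
  intro i
  have := h (-i)
  simp only [P_mir, Q_mir]
  omega

lemma P_lt {n : ℕ} (hn : 6 < n) {e : ZMod n → SignType} (h : Acyc n e) (i : ZMod n) :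
    P n e i < n := by
  have : NeZero n := ⟨by omega⟩
  by_contra hc
  have hall : ∀ k, e k = 1 := by
    intro k
    have := P_spec (e := e) (i := i) (t := (i - 1 - k).val)
      (lt_of_lt_of_le (ZMod.val_lt _) (not_lt.mp hc))
    simpa using this
  rcases h with h | ⟨_, ⟨b, hb⟩⟩
  · have := h 0; rw [hall] at this; exact absurd this (by decide)
  · rw [hall] at hb; exact absurd hb (by decide)

lemma P_zero {n : ℕ} {e : ZMod n → SignType} {i : ZMod n}
    (h : e (i - 1) ≠ 1) : P n e i = 0 := by
  by_contra hc
  have := P_spec (e := e) (i := i) (t := 0) (by omega)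
  simp at this
  exact h this

lemma P_succ {n : ℕ} (hn : 6 < n) {e : ZMod n → SignType} (ha : Acyc n e) {i : ZMod n}
    (h : e (i - 1) = 1) : P n e i = P n e (i - 1) + 1 := by
  apply le_antisymm
  · by_contra hc
    have h2 : P n e i - 1 ≤ P n e (i - 1) := by
      apply le_P (by have := P_le e i; omega)
      intro s hs
      have := P_spec (e := e) (i := i) (t := s + 1) (by omega)
      rw [← this]; congr 1; push_cast; ring
    omega
  · apply le_P (by have := P_lt hn ha (i - 1); omega)
    intro s hs
    rcases s with _ | s
    · simpa using h
    · have := P_spec (e := e) (i := i - 1) (t := s) (by omega)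
      rw [← this]; congr 1; push_cast; ring

lemma Q_zero {n : ℕ} {e : ZMod n → SignType} {i : ZMod n}
    (h : e i ≠ -1) : Q n e i = 0 := by
  by_contra hc
  have := Q_spec (e := e) (i := i) (t := 0) (by omega)
  simp at this
  exact h this

lemma Q_succ {n : ℕ} (hn : 6 < n) {e : ZMod n → SignType} (ha : Acyc n e) {i : ZMod n}
    (h : e i = -1) : Q n e i = Q n e (i + 1) + 1 := by
  have := P_succ hn (Acyc_mir ha) (i := -i) (by
    have h1 : (-1 - (-i - 1)) = i := by ring
    simp [mir, h1, h])
  rw [P_mir, P_mir] at this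
  have h2 : -(-i - 1) = i + 1 := by ring
  rw [h2, neg_neg] at this
  exact this

lemma cover {n : ℕ} (hn : 6 < n) (j i : ZMod n) :
    i = j ∨ i = j + 1 ∨ i = j + 2 ∨ ∃ t < n - 3, i = j - 1 - (t : ZMod n) := by
  have : NeZero n := ⟨by omega⟩
  have h1 : i = j - 1 - (((j - 1 - i).val : ℕ) : ZMod n) := by simp
  have h2 := ZMod.val_lt (j - 1 - i)
  generalize (j - 1 - i).val = t at h1 h2
  have hn0 : (n : ZMod n) = 0 := ZMod.natCast_self n
  by_cases h : t < n - 3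
  · exact Or.inr (Or.inr (Or.inr ⟨t, h, h1⟩))
  · have : t + 3 = n ∨ t + 2 = n ∨ t + 1 = n := by omega
    rcases this with h | h | h
    all_goals
      rw [← h] at hn0
      push_cast at hn0
      rw [h] at hn0
    · right; right; left; rw [h1]; linear_combination -hn0
    · right; left; rw [h1]; linear_combination -hn0
    · left; rw [h1]; linear_combination -hn0

lemma castsub {n : ℕ} (k : ℕ) (hk : k ≤ n) : ((n - k : ℕ) : ZMod n) = -(k : ZMod n) := by
  rw [Nat.cast_sub hk]; simp

lemma key {n : ℕ} (hn : 6 < n) {e e' : ZMod n → SignType} (ha : Acyc n e) (ha' : Acyc n e')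
    (H : Eqv n e e') {j : ZMod n} (hj : e j = -1) (hj' : e' j ≠ -1) : BadR n e j := by
  have hne : (1 : SignType) ≠ -1 := by decide
  have Q'j := Q_zero hj'
  have Qj := Q_succ hn ha hj
  have Hj := H j
  have full : n ≤ P n e j + Q n e j + 3 := by omega
  have full' : n ≤ P n e' j + 3 := by omega
  have run' : ∀ t < n - 3, e' (j - 1 - (t : ZMod n)) = 1 := fun t ht => P_spec (by omega)
  have r0 : e' (j - 1) = 1 := by simpa using run' 0 (by omega)
  have r1 : e' (j - 1 - 1) = 1 := by simpa using run' 1 (by omega)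
  have q1 : Q n e' (j - 1) = 0 := Q_zero (by rw [r0]; exact hne)
  have q2 : Q n e' (j - 1 - 1) = 0 := Q_zero (by rw [r1]; exact hne)
  have p0 := P_succ hn ha' r0
  have p1 := P_succ hn ha' r1
  have hex : e' (j + 1) = -1 ∨ e' (j + 2) = -1 := by
    rcases ha' with h | ⟨_, ⟨b, hb⟩⟩
    · rw [h] at r0; exact absurd r0 (by decide)
    · rcases cover hn j b with h | h | h | ⟨t, ht, h⟩
      · exact absurd (h ▸ hb) hj'
      · left; exact h ▸ hb
      · right; exact h ▸ hb
      · rw [h, run' t ht] at hb; exact absurd hb hne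
  have bound : P n e' j ≤ n - 2 := by
    by_contra hc
    have a1 := P_spec (e := e') (i := j) (t := n - 3) (by omega)
    have a2 := P_spec (e := e') (i := j) (t := n - 2) (by omega)
    rw [castsub _ (by omega)] at a1 a2
    have b1 : j - 1 - -((3 : ℕ) : ZMod n) = j + 2 := by push_cast; ring
    have b2 : j - 1 - -((2 : ℕ) : ZMod n) = j + 1 := by push_cast; ring
    rw [b1] at a1
    rw [b2] at a2
    rw [a1, a2] at hex
    exact absurd hex (by decide)
  have H2 := H (j - 1 - 1)
  have P2 : P n e (j - 1 - 1) = P n e' (j - 1 - 1) := by omega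
  have e4 : e (j - 4) = 1 := by
    have := P_spec (e := e) (i := j - 1 - 1) (t := 1) (by omega)
    rw [← this]; congr 1; push_cast; ring
  have s0 : e (j - 1) = 1 := by
    by_contra hc
    have z := P_zero hc
    have := Q_spec (e := e) (i := j) (t := n - 4) (by omega)
    rw [castsub _ (by omega)] at this
    have b : j + -((4 : ℕ) : ZMod n) = j - 4 := by push_cast; ring
    rw [b, e4] at this
    exact hne this
  have p0e := P_succ hn ha s0
  have s1 : e (j - 1 - 1) = 1 := by
    by_contra hc
    have z := P_zero hc
    have H1 := H (j - 1)
    have : P n e' j = n - 2 := by omega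
    have c1 := Q_spec (e := e) (i := j) (t := 2) (by omega)
    have c2 := P_spec (e := e) (i := j - 1 - 1) (t := n - 5) (by omega)
    rw [castsub _ (by omega)] at c2
    have b : j - 1 - 1 - 1 - -((5 : ℕ) : ZMod n) = j + (2 : ℕ) := by push_cast; ring
    rw [b, c1] at c2
    exact hne c2.symm
  have p1e := P_succ hn ha s1
  have run : ∀ t < n - 3, e (j - 1 - (t : ZMod n)) = 1 := fun t ht => P_spec (by omega)
  refine ⟨hj, run, ?_⟩
  have e3 : e (j + 2 + 1) = 1 := by
    have := run (n - 4) (by omega)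
    rw [castsub _ (by omega)] at this
    rw [← this]; congr 1; push_cast; ring
  have q3 : Q n e (j + 2 + 1) = 0 := Q_zero (by rw [e3]; exact hne)
  have q2b : Q n e (j + 2) ≤ 1 := by
    by_cases h : e (j + 2) = -1
    · have := Q_succ hn ha h; omega
    · have := Q_zero h; omega
  have q1b : Q n e (j + 1) ≤ 2 := by
    by_cases h : e (j + 1) = -1
    · have := Q_succ hn ha h
      have b : j + 1 + 1 = j + 2 := by ring
      rw [b] at this
      omega
    · have := Q_zero h; omega
  have pz : P n e (j + 1) = 0 := P_zero (by
    have b : j + 1 - 1 = j := by ring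
    rw [b, hj]; decide)
  have p2b : P n e (j + 2) ≤ 1 := by
    have b : j + 2 - 1 = j + 1 := by ring
    by_cases h : e (j + 2 - 1) = 1
    · have := P_succ hn ha h
      rw [b] at this
      omega
    · have := P_zero h; omega
  rcases hex with h | h
  · left
    by_contra hc
    have z := Q_zero hc
    have z' := Q_succ hn ha' h
    have := H (j + 1)
    omega
  · right
    by_contra hc
    have z := Q_zero hc
    have z' := Q_succ hn ha' h
    have := H (j + 2)
    omega

lemma Eqv_symm {n : ℕ} {e e' : ZMod n → SignType} (h : Eqv n e e') : Eqv n e' e := by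
  intro i; have := h i; omega

lemma inj {n : ℕ} (hn : 6 < n) {e e' : ZMod n → SignType} (ha : Acyc n e) (ha' : Acyc n e')
    (H : Eqv n e e') (hb : ¬ Bad n e) (hb' : ¬ Bad n e') : e = e' := by
  have main : ∀ e e' : ZMod n → SignType, Acyc n e → Acyc n e' → Eqv n e e' →
      ¬ Bad n e → ∀ j, (e j = -1 → e' j = -1) ∧ (e j = 1 → e' j = 1) := by
    intro e e' ha ha' H hb j
    constructor
    · intro h
      by_contra hc
      exact hb (Or.inl ⟨j, key hn ha ha' H h hc⟩)
    · intro h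
      by_contra hc
      have b : (-1 - (-1 - j)) = j := by ring
      refine hb (Or.inr ⟨-1 - j, key hn (Acyc_mir ha) (Acyc_mir ha') (Eqv_mir H) ?_ ?_⟩)
      · simp [mir, h]
      · simpa [mir] using hc
  funext j
  have h1 := main e e' ha ha' H hb j
  have h2 := main e' e ha' ha (Eqv_symm H) hb' j
  revert h1 h2
  generalize e j = a
  generalize e' j = b
  revert a b
  decide

lemma red {n : ℕ} (hn : 6 < n) {e : ZMod n → SignType} {j : ZMod n} (hb : BadR n e j) :
    Acyc n (Function.update e j 0) ∧ Eqv n e (Function.update e j 0) := by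
  have : Fact (1 < n) := ⟨by omega⟩
  obtain ⟨hj, run, hx⟩ := hb
  have r0 : e (j - 1) = 1 := by simpa using run 0 (by omega)
  have hne : (1 : SignType) ≠ -1 := by decide
  have one : (1 : ZMod n) ≠ 0 := one_ne_zero
  have two : (2 : ZMod n) ≠ 0 := by
    have := (ZMod.natCast_eq_zero_iff 2 n).not.mpr (fun h => by
      have := Nat.le_of_dvd (by norm_num) h; omega)
    simpa using this
  constructor
  · right
    refine ⟨⟨j - 1, by rw [Function.update_of_ne (by simp [one])]; exact r0⟩, ?_⟩
    rcases hx with h | h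
    · exact ⟨j + 1, by rw [Function.update_of_ne (by simp [one])]; exact h⟩
    · exact ⟨j + 2, by rw [Function.update_of_ne (by simp [two])]; exact h⟩
  · have hP : ∀ k, (Function.update e j 0 k = 1 ↔ e k = 1) := by
      intro k
      by_cases h : k = j
      · subst h; simp [hj]
      · rw [Function.update_of_ne h]
    have hPP : ∀ i, P n (Function.update e j 0) i = P n e i := by
      intro i; simp only [P, hP]
    intro i
    by_cases hi : i = j
    · right
      subst hi
      have := le_P (by omega) run
      rw [hPP]
      omega
    · left
      refine ⟨(hPP i).symm, ?_⟩
      have : ∀ m : ℕ, (∀ s < m, e (i + (s : ZMod n)) = -1) ↔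
          (∀ s < m, Function.update e j 0 (i + (s : ZMod n)) = -1) := by
        intro m
        constructor
        · intro h s hs
          by_cases hc : i + (s : ZMod n) = j
          · exfalso
            rcases s with _ | s
            · simp at hc; exact hi hc
            · have h3 := h s (by omega)
              have : i + (s : ZMod n) = j - 1 := by rw [← hc]; push_cast; ring
              rw [this, r0] at h3
              exact hne h3
          · rw [Function.update_of_ne hc]; exact h s hs
        · intro h s hs
          have := h s hs
          by_cases hc : i + (s : ZMod n) = j
          · rw [hc, Function.update_self] at this; exact absurd this (by decide)
          · rwa [Function.update_of_ne hc] at this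
      simp only [Q, this]

lemma Eqv_trans {n : ℕ} {e e' e'' : ZMod n → SignType} (h : Eqv n e e') (h' : Eqv n e' e'') :
    Eqv n e e'' := by
  intro i; have := h i; have := h' i; omega

open Classical in
noncomputable def nz (n : ℕ) [NeZero n] (e : ZMod n → SignType) : ℕ :=
  (Finset.univ.filter (fun i => e i ≠ 0)).card

lemma nz_update {n : ℕ} [NeZero n] {e : ZMod n → SignType} {j : ZMod n} (h : e j ≠ 0) :
    nz n (Function.update e j 0) < nz n e := by
  classical
  apply Finset.card_lt_card
  rw [Finset.ssubset_iff_of_subset]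
  · exact ⟨j, by simp [h], by simp⟩
  · intro i
    simp only [Finset.mem_filter, Finset.mem_univ, true_and]
    intro hi
    by_cases hc : i = j
    · subst hc; simp at hi
    · rwa [Function.update_of_ne hc] at hi

lemma exists_good {n : ℕ} (hn : 6 < n) [NeZero n] : ∀ (N : ℕ) (e : ZMod n → SignType), nz n e = N →
    Acyc n e → ∃ e', Acyc n e' ∧ ¬ Bad n e' ∧ Eqv n e e' := by
  intro N
  induction N using Nat.strong_induction_on with
  | _ N ih =>
    intro e hN ha
    by_cases hb : Bad n e
    · rcases hb with ⟨j, hb⟩ | ⟨j, hb⟩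
      · obtain ⟨h1, h2⟩ := red hn hb
        have hlt := nz_update (e := e) (j := j) (by rw [hb.1]; decide)
        obtain ⟨e', g1, g2, g3⟩ := ih _ (hN ▸ hlt) _ rfl h1
        exact ⟨e', g1, g2, Eqv_trans h2 g3⟩
      · obtain ⟨h1, h2⟩ := red hn hb
        have hm : mir n (Function.update (mir n e) j 0) = Function.update e (-1 - j) 0 := by
          funext i
          by_cases hc : i = -1 - j
          · subst hc; simp [mir]
          · rw [Function.update_of_ne hc]
            have : -1 - i ≠ j := fun h => hc (by rw [← h]; ring)
            simp [mir, Function.update_of_ne this]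
        have h1 := Acyc_mir h1
        have h2 := Eqv_mir h2
        rw [hm] at h1 h2
        rw [mir_mir] at h2
        have hlt := nz_update (e := e) (j := -1 - j) (by
          have := hb.1
          simp only [mir] at this
          intro h; rw [h] at this; exact absurd this (by decide))
        obtain ⟨e', g1, g2, g3⟩ := ih _ (hN ▸ hlt) _ rfl h1
        exact ⟨e', g1, g2, Eqv_trans h2 g3⟩
    · exact ⟨e, ha, hb, fun i => Or.inl ⟨rfl, rfl⟩⟩

def Mem (n : ℕ) (e : ZMod n → SignType) (i c : ZMod n) : Prop :=
  (∃ t ≤ P n e i + 1, i - (t : ZMod n) = c) ∨ (∃ t ≤ Q n e i + 1, i + (t : ZMod n) = c)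

lemma phi_iff {n : ℕ} (e : ZMod n → SignType) (x : ZMod n → Bool) (i : ZMod n) :
    phi n e x i = true ↔ ∀ c, Mem n e i c → x c = true := by
  simp only [phi, decide_eq_true_eq, Mem]
  constructor
  · rintro ⟨h1, h2⟩ c (⟨t, ht, rfl⟩ | ⟨t, ht, rfl⟩)
    · exact h1 t ht
    · exact h2 t ht
  · intro h
    exact ⟨fun t ht => h _ (Or.inl ⟨t, ht, rfl⟩), fun t ht => h _ (Or.inr ⟨t, ht, rfl⟩)⟩

lemma mem_iff {n : ℕ} (e : ZMod n → SignType) (i : ZMod n) (d : ℕ) (hd : d < n) :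
    Mem n e i (i + (d : ZMod n)) ↔ (d ≤ Q n e i + 1 ∨ n ≤ d + P n e i + 1) := by
  constructor
  · rintro (⟨t, ht, h⟩ | ⟨t, ht, h⟩)
    · have h0 : ((d + t : ℕ) : ZMod n) = 0 := by push_cast; linear_combination -h
      rw [ZMod.natCast_eq_zero_iff] at h0
      rcases Nat.eq_zero_or_pos (d + t) with h1 | h1
      · left; omega
      · have := Nat.le_of_dvd h1 h0
        right; omega
    · have h0 : ((t : ℕ) : ZMod n) = (d : ℕ) := by linear_combination h
      rw [ZMod.natCast_eq_natCast_iff] at h0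
      have h1 : t % n = d % n := h0
      rw [Nat.mod_eq_of_lt hd] at h1
      have := Nat.mod_le t n
      left; omega
  · rintro (h | h)
    · exact Or.inr ⟨d, h, rfl⟩
    · exact Or.inl ⟨n - d, by omega, by rw [castsub _ hd.le]; ring⟩

lemma phi_eq_iff {n : ℕ} (hn : 6 < n) (e e' : ZMod n → SignType) :
    phi n e = phi n e' ↔ Eqv n e e' := by
  classical
  have : NeZero n := ⟨by omega⟩
  constructor
  · intro h i
    have hm : ∀ c, Mem n e i c ↔ Mem n e' i c := by
      have aux : ∀ e e' : ZMod n → SignType, phi n e = phi n e' → ∀ c, Mem n e i c → Mem n e' i c := by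
        intro e e' h c hc
        have h1 : phi n e' (fun c => decide (Mem n e' i c)) i = true := by
          rw [phi_iff]; intro c hc; simpa using hc
        rw [← h, phi_iff] at h1
        simpa using h1 c hc
      exact fun c => ⟨aux e e' h c, aux e' e h.symm c⟩
    have hd : ∀ d < n, (d ≤ Q n e i + 1 ∨ n ≤ d + P n e i + 1) ↔
        (d ≤ Q n e' i + 1 ∨ n ≤ d + P n e' i + 1) := by
      intro d hd
      rw [← mem_iff e i d hd, ← mem_iff e' i d hd]; exact hm _
    generalize P n e i = p at *
    generalize Q n e i = q at *
    generalize P n e' i = p' at *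
    generalize Q n e' i = q' at *
    have a1 := hd (q + 1)
    have a2 := hd (q + 2)
    have a3 := hd (n - p - 1)
    have a4 := hd (n - p - 2)
    have b1 := hd (q' + 1)
    have b2 := hd (q' + 2)
    have b3 := hd (n - p' - 1)
    have b4 := hd (n - p' - 2)
    clear hd hm h
    by_cases f : n ≤ p + q + 3
    · by_cases f' : n ≤ p' + q' + 3
      · omega
      · omega
    · left
      constructor <;> omega
  · intro h
    funext x i
    rw [Bool.eq_iff_iff, phi_iff, phi_iff]
    have : ∀ c, Mem n e i c ↔ Mem n e' i c := by
      intro c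
      have hc : c = i + (((c - i).val : ℕ) : ZMod n) := by simp
      rw [hc, mem_iff _ _ _ (ZMod.val_lt _), mem_iff _ _ _ (ZMod.val_lt _)]
      have := h i
      omega
    simp only [this]

noncomputable def lb (n : ℕ) (τ : ZMod n → ℕ) : ZMod n → SignType :=
  fun i => SignType.sign ((τ (i + 1) : ℤ) - τ i)

lemma lb_acyc {n : ℕ} [NeZero n] (τ : ZMod n → ℕ) : Acyc n (lb n τ) := by
  have hs : ∑ i : ZMod n, ((τ (i + 1) : ℤ) - τ i) = 0 := by
    rw [Finset.sum_sub_distrib, sub_eq_zero]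
    exact Equiv.sum_comp (Equiv.addRight (1 : ZMod n)) (fun i => (τ i : ℤ))
  by_cases h1 : ∃ i, lb n τ i = 1
  · by_cases h2 : ∃ i, lb n τ i = -1
    · exact Or.inr ⟨h1, h2⟩
    · left
      have : ∀ i ∈ Finset.univ, 0 ≤ ((τ (i + 1) : ℤ) - τ i) := by
        intro i _
        by_contra hc
        exact h2 ⟨i, sign_eq_neg_one_iff.mpr (not_le.mp hc)⟩
      rw [Finset.sum_eq_zero_iff_of_nonneg this] at hs
      intro i
      simp [lb, hs i (Finset.mem_univ i)]
  · left
    have : ∀ i ∈ Finset.univ, ((τ (i + 1) : ℤ) - τ i) ≤ 0 := by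
      intro i _
      by_contra hc
      exact h1 ⟨i, sign_eq_one_iff.mpr (not_le.mp hc)⟩
    rw [Finset.sum_eq_zero_iff_of_nonpos this] at hs
    intro i
    simp [lb, hs i (Finset.mem_univ i)]

lemma lb_surj {n : ℕ} (hn : 6 < n) [NeZero n] {e : ZMod n → SignType} (ha : Acyc n e) :
    ∃ τ, lb n τ = e := by
  classical
  rcases ha with h | ⟨⟨a, ha⟩, ⟨b, hb⟩⟩
  · exact ⟨fun _ => 0, by funext i; simp [lb, h]⟩
  set A : ℤ := ((Finset.univ.filter (fun i => e i = 1)).card : ℤ) with hA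
  set B : ℤ := ((Finset.univ.filter (fun i => e i = -1)).card : ℤ) with hB
  have hA0 : 0 < A := by
    rw [hA]; exact_mod_cast Finset.card_pos.mpr ⟨a, by simp [ha]⟩
  have hB0 : 0 < B := by
    rw [hB]; exact_mod_cast Finset.card_pos.mpr ⟨b, by simp [hb]⟩
  let d : ZMod n → ℤ := fun i => (if e i = 1 then B else 0) + (if e i = -1 then -A else 0)
  have hd : ∀ i, SignType.sign (d i) = e i := by
    intro i
    have : e i = 1 ∨ e i = -1 ∨ e i = 0 := by generalize e i = s; revert s; decide
    rcases this with h | h | h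
    · simp [d, h, hB0]
    · simp [d, h, hA0]
    · simp [d, h]
  have hs : ∑ i, d i = 0 := by
    simp only [d, Finset.sum_add_distrib, ← Finset.sum_filter, Finset.sum_const, nsmul_eq_mul]
    rw [← hA, ← hB]; ring
  let F : ℕ → ℤ := fun k => ∑ s ∈ Finset.range k, d (s : ZMod n)
  have hF : F n = 0 := by
    rw [← hs]
    refine Finset.sum_bij' (fun s _ => (s : ZMod n)) (fun i _ => i.val) ?_ ?_ ?_ ?_ ?_
    · simp
    · intro i _; simpa using ZMod.val_lt i
    · intro s h; exact ZMod.val_cast_of_lt (by simpa using h)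
    · simp
    · simp
  obtain ⟨C, hC⟩ : ∃ C : ℤ, ∀ i : ZMod n, 0 ≤ C + F i.val := by
    refine ⟨∑ i : ZMod n, |F i.val|, fun i => ?_⟩
    have := Finset.single_le_sum (f := fun i : ZMod n => |F i.val|) (fun i _ => abs_nonneg _)
      (Finset.mem_univ i)
    have h2 := neg_abs_le (F i.val)
    linarith
  refine ⟨fun i => (C + F i.val).toNat, ?_⟩
  funext i
  simp only [lb]
  rw [Int.toNat_of_nonneg (hC _), Int.toNat_of_nonneg (hC _), ← hd i]
  congr 1
  have hstep : F (i.val + 1) = F i.val + d i := by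
    simp [F, Finset.sum_range_succ]
  have hi : F (i + 1).val = F (i.val + 1) := by
    have hl := ZMod.val_lt i
    by_cases h : i.val + 1 = n
    · have : i + 1 = 0 := by
        have h2 : ((i.val + 1 : ℕ) : ZMod n) = 0 := by rw [h]; simp
        simpa using h2
      rw [this, h, hF]; simp [F]
    · have : i + 1 = ((i.val + 1 : ℕ) : ZMod n) := by simp
      rw [this, ZMod.val_cast_of_lt (by omega)]
  rw [hi, hstep]; ring

lemma upTo_eq {n : ℕ} (h : Bool → Bool → Bool → Bool) (τ : ZMod n → ℕ) (x : ZMod n → Bool)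
    (k : ℕ) (i : ZMod n) :
    ecaUpTo n h τ k x i = if τ i ≤ k then ecaAsync n h τ x i else x i := by
  induction k with
  | zero =>
    by_cases hi : τ i = 0
    · simp [hi, ecaAsync]
    · simp [hi, ecaUpTo, ecaStep]
  | succ k ih =>
    by_cases hi : τ i = k + 1
    · simp [hi, ecaAsync]
    · simp only [ecaUpTo, ecaStep, hi, if_false, ih]
      have : (τ i ≤ k + 1) ↔ τ i ≤ k := by omega
      simp only [this]

lemma async_rec {n : ℕ} (h : Bool → Bool → Bool → Bool) (τ : ZMod n → ℕ) (x : ZMod n → Bool)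
    (i : ZMod n) :
    ecaAsync n h τ x i = h (if τ (i - 1) < τ i then ecaAsync n h τ x (i - 1) else x (i - 1)) (x i)
      (if τ (i + 1) < τ i then ecaAsync n h τ x (i + 1) else x (i + 1)) := by
  conv_lhs => unfold ecaAsync
  rcases hk : τ i with _ | k
  · simp [ecaUpTo, ecaStep, hk]
  · simp only [ecaUpTo, ecaStep, hk, if_true, upTo_eq, Nat.lt_succ_iff]
    simp

lemma forall_le_succ (p : ℕ → Prop) (m : ℕ) : (∀ t ≤ m + 1, p t) ↔ p 0 ∧ ∀ t ≤ m, p (t + 1) := by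
  constructor
  · intro h; exact ⟨h 0 (by omega), fun t ht => h _ (by omega)⟩
  · rintro ⟨h0, h1⟩ t ht
    rcases t with _ | t
    · exact h0
    · exact h1 t (by omega)

lemma async_eq {n : ℕ} (hn : 6 < n) [NeZero n] (τ : ZMod n → ℕ) :
    ecaAsync n (fun a b c => a && b && c) τ = phi n (lb n τ) := by
  have ha := lb_acyc τ
  funext x i
  rw [Bool.eq_iff_iff]
  induction hN : τ i using Nat.strong_induction_on generalizing i with
  | _ N ih =>
    have lbl : lb n τ (i - 1) = 1 ↔ τ (i - 1) < τ i := by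
      simp only [lb, sign_eq_one_iff, sub_add_cancel]; omega
    have lbr : lb n τ i = -1 ↔ τ (i + 1) < τ i := by
      simp only [lb, sign_eq_neg_one_iff]; omega
    have left : (if τ (i - 1) < τ i then ecaAsync n (fun a b c => a && b && c) τ x (i - 1)
        else x (i - 1)) = true ∧ x i = true ↔
        ∀ t ≤ P n (lb n τ) i + 1, x (i - (t : ZMod n)) = true := by
      by_cases h : τ (i - 1) < τ i
      · rw [if_pos h, ih _ (hN ▸ h) (i - 1) rfl, P_succ hn ha (lbl.mpr h), forall_le_succ]
        have hq : Q n (lb n τ) (i - 1) = 0 := Q_zero (by rw [lbl.mpr h]; decide)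
        simp only [phi, decide_eq_true_eq, hq]
        have c1 : ∀ t : ℕ, i - ((t + 1 : ℕ) : ZMod n) = i - 1 - t := by intro t; push_cast; ring
        simp only [c1]
        constructor
        · rintro ⟨⟨h1, _⟩, h2⟩; exact ⟨by simpa using h2, h1⟩
        · rintro ⟨h1, h2⟩
          refine ⟨⟨h2, ?_⟩, by simpa using h1⟩
          rw [forall_le_succ]
          refine ⟨by simpa using h2 0 (by omega), ?_⟩
          intro t ht
          have : t = 0 := by omega
          subst this
          simpa using h1
      · rw [if_neg h, P_zero (lbl.not.mpr h), forall_le_succ]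
        constructor
        · rintro ⟨h1, h2⟩
          refine ⟨by simpa using h2, fun t ht => ?_⟩
          have : t = 0 := by omega
          subst this; simpa using h1
        · rintro ⟨h1, h2⟩
          exact ⟨by simpa using h2 0 le_rfl, by simpa using h1⟩
    have right : (if τ (i + 1) < τ i then ecaAsync n (fun a b c => a && b && c) τ x (i + 1)
        else x (i + 1)) = true ∧ x i = true ↔
        ∀ t ≤ Q n (lb n τ) i + 1, x (i + (t : ZMod n)) = true := by
      by_cases h : τ (i + 1) < τ i
      · rw [if_pos h, ih _ (hN ▸ h) (i + 1) rfl, Q_succ hn ha (lbr.mpr h), forall_le_succ]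
        have hq : P n (lb n τ) (i + 1) = 0 := P_zero (by
          rw [add_sub_cancel_right, lbr.mpr h]; decide)
        simp only [phi, decide_eq_true_eq, hq]
        have c1 : ∀ t : ℕ, i + ((t + 1 : ℕ) : ZMod n) = i + 1 + t := by intro t; push_cast; ring
        simp only [c1]
        constructor
        · rintro ⟨⟨_, h1⟩, h2⟩; exact ⟨by simpa using h2, h1⟩
        · rintro ⟨h1, h2⟩
          refine ⟨⟨?_, h2⟩, by simpa using h1⟩
          rw [forall_le_succ]
          refine ⟨by simpa using h2 0 (by omega), ?_⟩
          intro t ht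
          have : t = 0 := by omega
          subst this
          simpa using h1
      · rw [if_neg h, Q_zero (lbr.not.mpr h), forall_le_succ]
        constructor
        · rintro ⟨h1, h2⟩
          refine ⟨by simpa using h2, fun t ht => ?_⟩
          have : t = 0 := by omega
          subst this; simpa using h1
        · rintro ⟨h1, h2⟩
          exact ⟨by simpa using h2 0 le_rfl, by simpa using h1⟩
    rw [async_rec]
    simp only [phi, decide_eq_true_eq]
    rw [← left, ← right]
    simp only [Bool.and_eq_true]
    tauto

/-! Counting -/

open Classical in
lemma card_acyc {n : ℕ} (hn : 6 < n) [NeZero n] :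
    (Finset.univ.filter (fun e : ZMod n → SignType => Acyc n e)).card + 2 * 2 ^ n = 3 ^ n + 2 := by
  have cardpi : ∀ s : Finset SignType,
      (Finset.univ.filter (fun e : ZMod n → SignType => ∀ i, e i ∈ s)).card = s.card ^ n := by
    intro s
    have : (Finset.univ.filter (fun e : ZMod n → SignType => ∀ i, e i ∈ s)) =
        Fintype.piFinset (fun _ : ZMod n => s) := by
      ext e; simp
    rw [this, Fintype.card_piFinset]
    simp [ZMod.card]
  set X := Finset.univ.filter (fun e : ZMod n → SignType => ∀ i, e i ∈ ({0, 1} : Finset SignType)) with hX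
  set Y := Finset.univ.filter (fun e : ZMod n → SignType => ∀ i, e i ∈ ({0, -1} : Finset SignType)) with hY
  have cX : X.card = 2 ^ n := by rw [hX, cardpi]; rfl
  have cY : Y.card = 2 ^ n := by rw [hY, cardpi]; rfl
  have cXY : (X ∩ Y) = {fun _ => 0} := by
    ext e
    simp only [hX, hY, Finset.mem_inter, Finset.mem_filter, Finset.mem_univ, true_and,
      Finset.mem_singleton]
    constructor
    · rintro ⟨h1, h2⟩
      funext i
      have := h1 i; have := h2 i
      generalize e i = a at *
      revert a; decide
    · rintro rfl; simp
  have hu := Finset.card_union_add_card_inter X Y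
  rw [cXY, cX, cY, Finset.card_singleton] at hu
  have hz : (fun _ => 0 : ZMod n → SignType) ∈ X ∪ Y := by simp [hX]
  have hA : Finset.univ.filter (fun e : ZMod n → SignType => Acyc n e) =
      Finset.univ \ ((X ∪ Y).erase (fun _ => 0)) := by
    ext e
    simp only [hX, hY, Finset.mem_filter, Finset.mem_univ, true_and, Finset.mem_sdiff,
      Finset.mem_erase, Finset.mem_union]
    unfold Acyc
    have t1 : ∀ i, e i ∈ ({0, 1} : Finset SignType) ↔ e i ≠ -1 := by
      intro i; generalize e i = a; revert a; decide
    have t2 : ∀ i, e i ∈ ({0, -1} : Finset SignType) ↔ e i ≠ 1 := by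
      intro i; generalize e i = a; revert a; decide
    simp only [t1, t2, ← not_exists, ne_eq, funext_iff]
    tauto
  rw [hA, Finset.card_sdiff_of_subset (Finset.subset_univ _), Finset.card_erase_of_mem hz]
  have htot : (Finset.univ : Finset (ZMod n → SignType)).card = 3 ^ n := by
    rw [Finset.card_univ, Fintype.card_fun, ZMod.card]; rfl
  have hle := Finset.card_le_card (Finset.subset_univ (X ∪ Y))
  rw [htot] at hle ⊢
  omega

lemma small {n : ℕ} (hn : 6 < n) (k : ℕ) (h0 : 0 < k) (hk : k < n) : (k : ZMod n) ≠ 0 := by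
  rw [Ne, ZMod.natCast_eq_zero_iff]
  intro h
  have := Nat.le_of_dvd h0 h
  omega

def E (n : ℕ) (j : ZMod n) (a b : SignType) : ZMod n → SignType :=
  fun i => if i = j then -1 else if i = j + 1 then a else if i = j + 2 then b else 1

lemma E_bad {n : ℕ} (hn : 6 < n) (j : ZMod n) (a b : SignType) (h : a = -1 ∨ b = -1) :
    BadR n (E n j a b) j := by
  have one := small hn 1 (by omega) (by omega)
  have two := small hn 2 (by omega) (by omega)
  push_cast at one two
  refine ⟨by simp [E], ?_, ?_⟩
  · intro t ht
    have g1 := small hn (t + 1) (by omega) (by omega)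
    have g2 := small hn (t + 2) (by omega) (by omega)
    have g3 := small hn (t + 3) (by omega) (by omega)
    push_cast at g1 g2 g3
    unfold E
    rw [if_neg, if_neg, if_neg]
    · intro h; apply g3; linear_combination -h
    · intro h; apply g2; linear_combination -h
    · intro h; apply g1; linear_combination -h
  · have c : (2 : ZMod n) ≠ 1 := by
      intro h; apply one; linear_combination h
    simpa [E, one, two, c] using h

lemma bad_E {n : ℕ} (hn : 6 < n) {e : ZMod n → SignType} {j : ZMod n} (h : BadR n e j) :
    e = E n j (e (j + 1)) (e (j + 2)) := by
  have hx := E_bad hn j _ _ h.2.2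
  have one := small hn 1 (by omega) (by omega)
  have two := small hn 2 (by omega) (by omega)
  push_cast at one two
  have c : (2 : ZMod n) ≠ 1 := by
      intro h; apply one; linear_combination h
  funext i
  rcases cover hn j i with rfl | rfl | rfl | ⟨t, ht, rfl⟩
  · rw [h.1, hx.1]
  · simp [E, one]
  · simp [E, two, c]
  · rw [h.2.1 t ht, hx.2.1 t ht]

lemma bad_loc {n : ℕ} (hn : 6 < n) {e : ZMod n → SignType} {j i : ZMod n} (h : BadR n e j)
    (hi : e i = -1) : i = j ∨ i = j + 1 ∨ i = j + 2 := by
  rcases cover hn j i with h1 | h1 | h1 | ⟨t, ht, rfl⟩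
  · exact Or.inl h1
  · exact Or.inr (Or.inl h1)
  · exact Or.inr (Or.inr h1)
  · rw [h.2.1 t ht] at hi; exact absurd hi (by decide)

lemma bad_uniq {n : ℕ} (hn : 6 < n) {e : ZMod n → SignType} {j k : ZMod n} (h : BadR n e j)
    (h' : BadR n e k) : j = k := by
  have g1 := small hn 1 (by omega) (by omega)
  have g2 := small hn 2 (by omega) (by omega)
  have g3 := small hn 3 (by omega) (by omega)
  have g4 := small hn 4 (by omega) (by omega)
  push_cast at g1 g2 g3 g4
  rcases bad_loc hn h h'.1 with a | a | a
  · exact a.symm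
  all_goals
    exfalso
    rcases bad_loc hn h' h.1 with b | b | b
    · first
        | exact g1 (by linear_combination -a - b)
        | exact g2 (by linear_combination -a - b)
    · first
        | exact g2 (by linear_combination -a - b)
        | exact g3 (by linear_combination -a - b)
    · first
        | exact g3 (by linear_combination -a - b)
        | exact g4 (by linear_combination -a - b)

lemma bad_disj {n : ℕ} (hn : 6 < n) {e : ZMod n → SignType} {j k : ZMod n} (h : BadR n e j)
    (h' : BadR n (mir n e) k) : False := by
  have g1 := small hn 1 (by omega) (by omega)
  have g2 := small hn 2 (by omega) (by omega)
  have g3 := small hn 3 (by omega) (by omega)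
  have g4 := small hn 4 (by omega) (by omega)
  have g5 := small hn 5 (by omega) (by omega)
  push_cast at g1 g2 g3 g4 g5
  have r0 := h'.2.1 0 (by omega)
  have r3 := h'.2.1 3 (by omega)
  simp only [mir, neg_eq_iff_eq_neg] at r0 r3
  push_cast at r0 r3
  rcases bad_loc hn h r0 with a | a | a <;> rcases bad_loc hn h r3 with b | b | b
  all_goals
    first
      | exact g1 (by linear_combination b - a)
      | exact g2 (by linear_combination b - a)
      | exact g3 (by linear_combination b - a)
      | exact g4 (by linear_combination b - a)
      | exact g5 (by linear_combination b - a)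

open Classical in
lemma card_badR {n : ℕ} (hn : 6 < n) [NeZero n] :
    (Finset.univ.filter (fun e : ZMod n → SignType => ∃ j, BadR n e j)).card = 5 * n := by
  set S : Finset (SignType × SignType) := Finset.univ.filter (fun p => p.1 = -1 ∨ p.2 = -1) with hS
  have cS : S.card = 5 := by
    rw [hS]; decide +revert
  have : (Finset.univ.filter (fun e : ZMod n → SignType => ∃ j, BadR n e j)) =
      ((Finset.univ : Finset (ZMod n)) ×ˢ S).image (fun p => E n p.1 p.2.1 p.2.2) := by
    ext e
    simp only [Finset.mem_filter, Finset.mem_univ, true_and, Finset.mem_image, Finset.mem_product,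
      hS, Prod.exists]
    constructor
    · rintro ⟨j, h⟩
      exact ⟨j, _, _, h.2.2, (bad_E hn h).symm⟩
    · rintro ⟨j, a, b, h, rfl⟩
      exact ⟨j, E_bad hn j a b h⟩
  rw [this, Finset.card_image_of_injOn, Finset.card_product, cS, Finset.card_univ, ZMod.card, mul_comm]
  rintro ⟨j, a, b⟩ h ⟨j', a', b'⟩ h' heq
  simp only [hS, Finset.coe_product, Set.mem_prod, Finset.mem_coe, Finset.mem_filter,
    Finset.mem_univ, true_and] at h h' heq
  have x := E_bad hn j a b h
  have y := E_bad hn j' a' b' h'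
  rw [← heq] at y
  obtain rfl := bad_uniq hn x y
  have one := small hn 1 (by omega) (by omega)
  have two := small hn 2 (by omega) (by omega)
  push_cast at one two
  have c : (2 : ZMod n) ≠ 1 := by
      intro h; apply one; linear_combination h
  have e1 := congrFun heq (j + 1)
  have e2 := congrFun heq (j + 2)
  simp [E, one, two, c] at e1 e2
  rw [e1, e2]

open Classical in
lemma card_bad {n : ℕ} (hn : 6 < n) [NeZero n] :
    (Finset.univ.filter (fun e : ZMod n → SignType => Bad n e)).card = 10 * n := by
  have h1 : (Finset.univ.filter (fun e : ZMod n → SignType => Bad n e)) =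
      Finset.univ.filter (fun e : ZMod n → SignType => ∃ j, BadR n e j) ∪
      (Finset.univ.filter (fun e : ZMod n → SignType => ∃ j, BadR n e j)).image (mir n) := by
    ext e
    simp only [Finset.mem_filter, Finset.mem_univ, true_and, Finset.mem_image, Finset.mem_union]
    unfold Bad
    constructor
    · rintro (h | h)
      · exact Or.inl h
      · exact Or.inr ⟨mir n e, h, mir_mir n e⟩
    · rintro (h | ⟨e', h, rfl⟩)
      · exact Or.inl h
      · right; rwa [mir_mir]
  rw [h1, Finset.card_union_of_disjoint, Finset.card_image_of_injective, card_badR hn]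
  · ring
  · exact Function.LeftInverse.injective (mir_mir n)
  · rw [Finset.disjoint_left]
    intro e h h'
    simp only [Finset.mem_filter, Finset.mem_univ, true_and, Finset.mem_image] at h h'
    obtain ⟨e', ⟨k, hk⟩, rfl⟩ := h'
    obtain ⟨j, hj⟩ := h
    refine bad_disj hn hj (k := k) ?_
    rwa [mir_mir]

lemma badR_acyc {n : ℕ} (hn : 6 < n) {e : ZMod n → SignType} {j : ZMod n} (h : BadR n e j) :
    Acyc n e :=
  Or.inr ⟨⟨_, h.2.1 0 (by omega)⟩, ⟨j, h.1⟩⟩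

lemma bad_acyc {n : ℕ} (hn : 6 < n) {e : ZMod n → SignType} (h : Bad n e) : Acyc n e := by
  rcases h with ⟨j, h⟩ | ⟨j, h⟩
  · exact badR_acyc hn h
  · have := Acyc_mir (badR_acyc hn h)
    rwa [mir_mir] at this

lemma arith {n : ℕ} (hn : 6 < n) : 2 * 2 ^ n + 10 * n ≤ 3 ^ n := by
  induction n, hn using Nat.le_induction with
  | base => norm_num
  | succ k hk ih =>
    rw [pow_succ, pow_succ]
    have : 10 ≤ 2 ^ k := le_trans (by norm_num) (Nat.pow_le_pow_right (by norm_num) hk)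
    omega

end R128

/-- Rule 128 (h a b c = a ∧ b ∧ c): the number of distinct asynchronous
global functions equals $3^n - 2^{n+1} - 10n + 2$. -/
theorem rule_128_count (n : ℕ) (hn : 6 < n) :
    {g | ∃ τ : ZMod n → ℕ, g = ecaAsync n (fun a b c => a && b && c) τ}.ncard
      = 3 ^ n - 2 ^ (n + 1) - 10 * n + 2 := by
  classical
  have : NeZero n := ⟨by omega⟩
  have hset : {g | ∃ τ : ZMod n → ℕ, g = ecaAsync n (fun a b c => a && b && c) τ} =
      R128.phi n '' ((Finset.univ.filter (fun e : ZMod n → SignType => R128.Acyc n e) \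
        Finset.univ.filter (fun e : ZMod n → SignType => R128.Bad n e) :
          Finset (ZMod n → SignType)) : Set (ZMod n → SignType)) := by
    ext g
    simp only [Set.mem_ofPred_eq, Set.mem_image, Finset.mem_coe, Finset.mem_sdiff,
      Finset.mem_filter, Finset.mem_univ, true_and]
    constructor
    · rintro ⟨τ, rfl⟩
      obtain ⟨e', h1, h2, h3⟩ := R128.exists_good hn _ _ rfl (R128.lb_acyc τ)
      refine ⟨e', ⟨h1, h2⟩, ?_⟩
      rw [R128.async_eq hn]
      exact ((R128.phi_eq_iff hn _ _).mpr h3).symm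
    · rintro ⟨e, ⟨h1, _⟩, rfl⟩
      obtain ⟨τ, rfl⟩ := R128.lb_surj hn h1
      exact ⟨τ, (R128.async_eq hn τ).symm⟩
  rw [hset, Set.ncard_image_of_injOn, Set.ncard_coe_finset, Finset.card_sdiff_of_subset,
    R128.card_bad hn]
  · have h1 := R128.card_acyc hn
    have h2 := R128.arith hn
    rw [pow_succ]
    omega
  · intro e
    simp only [Finset.mem_filter, Finset.mem_univ, true_and]
    exact R128.bad_acyc hn
  · intro e he e' he' heq
    simp only [Finset.mem_coe, Finset.mem_sdiff, Finset.mem_filter, Finset.mem_univ, true_and] at he he'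
    exact R128.inj hn he.1 he'.1 ((R128.phi_eq_iff hn _ _).mp heq) he.2 he'.2
end

section
/- For the ECA rule 160, with local rule h(a,b,c) = a ∧ c, and for every n > 8: the number of distinct asynchronous global functions, i.e. the cardinality of { f^{(τ)} : τ a block-sequential update schedule on ℤ/nℤ }, equals 3^n − 2^{n+1} − 12n + 2. -/
namespace R160

def Rr {n : ℕ} (s : ZMod n → SignType) (M : ZMod n → ZMod n → Prop) (i j : ZMod n) : Prop :=
  if s i = -1 then M (i+1) j else j = i+1

def Lr {n : ℕ} (s : ZMod n → SignType) (M : ZMod n → ZMod n → Prop) (i j : ZMod n) : Prop :=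
  if s (i-1) = 1 then M (i-1) j else j = i-1

def Rc {n : ℕ} (s : ZMod n → SignType) (M : ZMod n → ZMod n → Prop) : Prop :=
  ∀ i j, M i j ↔ (Lr s M i j ∨ Rr s M i j)

def rf {n : ℕ} (s : ZMod n → SignType) : ZMod n → SignType := fun k => - s (-1 - k)

def rfM {n : ℕ} (M : ZMod n → ZMod n → Prop) : ZMod n → ZMod n → Prop := fun i j => M (-i) (-j)

def Valid {n : ℕ} (s : ZMod n → SignType) : Prop :=
  (∀ k, s k = 0) ∨ ((∃ k, s k = 1) ∧ ∃ k, s k = -1)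

lemma neg_eq_one (x : SignType) : -x = 1 ↔ x = -1 := by revert x; decide
lemma neg_eq_neg_one (x : SignType) : -x = -1 ↔ x = 1 := by revert x; decide

lemma rf_rf {n : ℕ} (s : ZMod n → SignType) : rf (rf s) = s := by
  funext k; simp [rf]

lemma rfM_rfM {n : ℕ} (M : ZMod n → ZMod n → Prop) : rfM (rfM M) = M := by
  funext i j; simp [rfM]

lemma Rc_rf {n : ℕ} {s : ZMod n → SignType} {M : ZMod n → ZMod n → Prop} (h : Rc s M) :
    Rc (rf s) (rfM M) := by
  intro i j
  have h1 := h (-i) (-j)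
  have e1 : (-1 - (i - 1) : ZMod n) = -i := by ring
  have e2 : (-1 - i : ZMod n) = -i - 1 := by ring
  have e3 : (-(i-1) : ZMod n) = -i + 1 := by ring
  have e4 : (-(i+1) : ZMod n) = -i - 1 := by ring
  have e5 : (j = i - 1) ↔ (-j = -i + 1) := by
    rw [← neg_inj, e3]
  have e6 : (j = i + 1) ↔ (-j = -i - 1) := by
    rw [← neg_inj, e4]
  simp only [Lr, Rr, rf, rfM, e1, e2, e3, e4, e5, e6, neg_eq_one, neg_eq_neg_one] at h1 ⊢
  rw [h1, or_comm]

lemma Valid_rf {n : ℕ} {s : ZMod n → SignType} (h : Valid s) : Valid (rf s) := by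
  rcases h with h | ⟨⟨a, ha⟩, b, hb⟩
  · left; intro k; simp [rf, h]
  · right
    exact ⟨⟨-1 - b, by simp [rf, hb]⟩, ⟨-1 - a, by simp [rf, ha]⟩⟩

lemma Rr_step {n : ℕ} {s : ZMod n → SignType} {M : ZMod n → ZMod n → Prop} (h : Rc s M)
    (i j : ZMod n) : Rr s M i j ↔ if s i = -1 then (j = i ∨ Rr s M (i+1) j) else j = i+1 := by
  by_cases hs : s i = -1
  · have h1 := h (i+1) j
    have : Lr s M (i+1) j ↔ j = i := by
      simp [Lr, hs]
    rw [if_pos hs, ← this, ← h1, Rr, if_pos hs]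
  · simp [Rr, hs]

lemma Lr_step {n : ℕ} {s : ZMod n → SignType} {M : ZMod n → ZMod n → Prop} (h : Rc s M)
    (i j : ZMod n) : Lr s M i j ↔ if s (i-1) = 1 then (j = i ∨ Lr s M (i-1) j) else j = i-1 := by
  by_cases hs : s (i-1) = 1
  · have h1 := h (i-1) j
    have : Rr s M (i-1) j ↔ j = i := by
      simp [Rr, hs]
    rw [if_pos hs, ← this, or_comm, ← h1, Lr, if_pos hs]
  · simp [Lr, hs]

lemma natcast_inj {n : ℕ} {a b : ℕ} (ha : a < n) (hb : b < n) :
    ((a : ZMod n) = b) ↔ a = b := by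
  rw [ZMod.natCast_eq_natCast_iff]
  exact ⟨fun h => Nat.ModEq.eq_of_lt_of_lt h ha hb, fun h => h ▸ Nat.ModEq.refl _⟩

lemma sub_nat {n : ℕ} (k : ZMod n) {c : ℕ} (hc : c ≤ n) : k - c = k + ((n - c : ℕ) : ZMod n) := by
  rw [Nat.cast_sub hc]; simp [sub_eq_add_neg]

/-- coordinates -/
lemma exists_coord {n : ℕ} (hn : 8 < n) (i j : ZMod n) : ∃ v : ℕ, v < n ∧ j = i + v := by
  have : NeZero n := ⟨by omega⟩
  exact ⟨(j - i).val, ZMod.val_lt _, by simp⟩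

lemma arcs {n : ℕ} (hn : 8 < n) (p q : ZMod n) :
    ∃ t u : ℕ, t < n - 4 ∧ u < n - 4 ∧ p + t = q + u := by
  obtain ⟨d, hd, rfl⟩ := exists_coord hn p q
  by_cases h : d < n - 4
  · exact ⟨d, 0, h, by omega, by simp⟩
  · refine ⟨0, n - d, by omega, by omega, ?_⟩
    rw [Nat.cast_sub hd.le]; simp

lemma arcs' {n : ℕ} (hn : 8 < n) (p q : ZMod n) :
    ∃ t u : ℕ, t < n - 4 ∧ u < n - 4 ∧ p + t = q - u := by
  obtain ⟨t, u, ht, hu, h⟩ := arcs hn p (q - (n - 5 : ℕ))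
  refine ⟨t, n - 5 - u, ht, by omega, ?_⟩
  rw [h, Nat.cast_sub (show u ≤ n - 5 by omega)]; ring

lemma far {n : ℕ} {s : ZMod n → SignType} {M : ZMod n → ZMod n → Prop} (h : Rc s M)
    (j : ZMod n) (t : ℕ) : ∀ k : ZMod n, s (k - 1) ≠ 1 → s (k + t) ≠ -1 → M k j →
    ∃ u : ℕ, u ≤ t + 2 ∧ j = k - 1 + u := by
  induction t with
  | zero =>
    intro k h1 h2 hM
    rw [h, Lr, Rr, if_neg h1, if_neg (by simpa using h2)] at hM
    rcases hM with rfl | rfl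
    · exact ⟨0, by omega, by simp⟩
    · exact ⟨2, by omega, by push_cast; ring⟩
  | succ t ih =>
    intro k h1 h2 hM
    rw [h, Lr, Rr, if_neg h1] at hM
    rcases hM with rfl | hM
    · exact ⟨0, by omega, by simp⟩
    · by_cases hs : s k = -1
      · rw [if_pos hs] at hM
        obtain ⟨u, hu, rfl⟩ := ih (k+1) (by simp [hs]) (by
          convert h2 using 2; push_cast; ring) hM
        exact ⟨u + 1, by omega, by push_cast; ring⟩
      · rw [if_neg hs] at hM
        exact ⟨2, by omega, by rw [hM]; push_cast; ring⟩

lemma near {n : ℕ} {s : ZMod n → SignType} {M : ZMod n → ZMod n → Prop} (h : Rc s M)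
    (k : ZMod n) (hk : s (k - 1) = 1) : M k (k - 2) ∨ M k (k - 3) := by
  have e1 : k - 1 - 1 = k - 2 := by ring
  have e2 : k - 2 - 1 = k - 3 := by ring
  rw [h, h, Lr_step h, if_pos hk, Lr_step h _ (k-3), if_pos hk, Lr_step h, Lr_step h _ (k-3), e1]
  by_cases h2 : s (k - 2) = 1
  · rw [if_pos h2, if_pos h2, Lr_step h, Lr_step h _ (k-3), e2]
    by_cases h3 : s (k - 3) = 1
    · rw [if_pos h3]; simp
    · rw [if_neg h3, if_neg h3]; simp
  · rw [if_neg h2]; simp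

lemma main1 {n : ℕ} (hn : 8 < n) {s s' : ZMod n → SignType} {M : ZMod n → ZMod n → Prop}
    (h : Rc s M) (h' : Rc s' M) (k : ZMod n) (hk : s (k - 1) ≠ 1) (t : ℕ) (ht : t < n - 4)
    (hs : s (k + t) ≠ -1) : s' (k - 1) ≠ 1 := by
  intro hk'
  rcases near h' k hk' with hM | hM
  · obtain ⟨u, hu, e⟩ := far h _ t k hk hs hM
    have e2 : k - 2 = k - 1 + ((n - 1 : ℕ) : ZMod n) := by
      rw [← sub_nat _ (by omega)]; push_cast; ring
    rw [e2, add_right_inj, natcast_inj (by omega) (by omega)] at e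
    omega
  · obtain ⟨u, hu, e⟩ := far h _ t k hk hs hM
    have e2 : k - 3 = k - 1 + ((n - 2 : ℕ) : ZMod n) := by
      rw [← sub_nat _ (by omega)]; push_cast; ring
    rw [e2, add_right_inj, natcast_inj (by omega) (by omega)] at e
    omega

lemma main2 {n : ℕ} (hn : 8 < n) {s s' : ZMod n → SignType} {M : ZMod n → ZMod n → Prop}
    (h : Rc s M) (h' : Rc s' M) (k : ZMod n) (hk : s k ≠ -1) (t : ℕ) (ht : t < n - 4)
    (hs : s (k - 1 - t) ≠ 1) : s' k ≠ -1 := by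
  have := main1 hn (Rc_rf h) (Rc_rf h') (-k) (by
    rw [rf, Ne, neg_eq_one]; convert hk using 3; ring) t ht (by
    rw [rf, Ne, neg_eq_neg_one]; convert hs using 3; ring)
  rw [rf, Ne, neg_eq_one] at this
  convert this using 3; ring

lemma half {n : ℕ} (hn : 8 < n) {s s' : ZMod n → SignType} {M : ZMod n → ZMod n → Prop}
    (h : Rc s M) (h' : Rc s' M) (hv : Valid s) (k : ZMod n)
    (hl : ∀ t : ℕ, t < n - 4 → s (k + t) = -1) : ∀ q, s q = -1 ↔ s' q = -1 := by
  classical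
  have A : ∀ q, s' q = -1 → s q = -1 := by
    intro q hq
    by_contra hq'
    obtain ⟨t, u, ht, hu, e⟩ := arcs' hn k (q - 1)
    refine main2 hn h h' q hq' u hu ?_ hq
    rw [← e, hl t ht]; decide
  have hex : ∃ T : ℕ, s (k + T) ≠ -1 := by
    have : ∃ q, s q ≠ -1 := by
      rcases hv with hv | ⟨⟨a, ha⟩, -⟩
      · exact ⟨0, by rw [hv]; decide⟩
      · exact ⟨a, by rw [ha]; decide⟩
    obtain ⟨q, hq⟩ := this
    obtain ⟨v, -, rfl⟩ := exists_coord hn k q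
    exact ⟨v, hq⟩
  have hT := Nat.find_spec hex
  have hmin : ∀ m < Nat.find hex, s (k + m) = -1 := fun m hm => by
    simpa using Nat.find_min hex hm
  set T := Nat.find hex
  have hTn : n - 4 ≤ T := by
    by_contra hlt
    exact hT (hl T (by omega))
  have B : ∀ u : ℕ, u < n - 4 → s' (k + (T - 1 : ℕ) - u) ≠ 1 := by
    intro u hu
    have e0 : k + (T - 1 : ℕ) - u = k + ((T - 1 - u : ℕ) : ZMod n) := by
      rw [Nat.cast_sub (show u ≤ T - 1 by omega)]; ring
    have := main1 hn h h' (k + (T - 1 : ℕ) - u + 1) (by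
      rw [add_sub_cancel_right, e0, hmin _ (by omega)]; decide) u hu (by
      convert hT using 2
      rw [Nat.cast_sub (show 1 ≤ T by omega)]; push_cast; ring)
    rwa [add_sub_cancel_right] at this
  intro q
  refine ⟨fun hq => ?_, A q⟩
  by_contra hq'
  obtain ⟨t, u, ht, hu, e⟩ := arcs' hn (q - 1 - (n - 5 : ℕ)) (k + (T - 1 : ℕ))
  refine main2 hn h' h q hq' (n - 5 - t) (by omega) ?_ hq
  have : q - 1 - ((n - 5 - t : ℕ) : ZMod n) = k + (T - 1 : ℕ) - u := by
    rw [← e, Nat.cast_sub (show t ≤ n - 5 by omega)]; ring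
  rw [this]; exact B u hu

lemma half' {n : ℕ} (hn : 8 < n) {s s' : ZMod n → SignType} {M : ZMod n → ZMod n → Prop}
    (h : Rc s M) (h' : Rc s' M) (hv : Valid s) (q : ZMod n)
    (hl : ∀ t : ℕ, t < n - 4 → s (q - 1 - t) = 1) : ∀ q, s q = 1 ↔ s' q = 1 := by
  have := half hn (Rc_rf h) (Rc_rf h') (Valid_rf hv) (-q) (by
    intro t ht
    rw [rf, neg_eq_neg_one]
    rw [← hl t ht]; congr 1; ring)
  intro k
  simpa [rf, neg_eq_neg_one] using this (-1 - k)

/-- the admissible pairs -/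
abbrev G : Type := {p : SignType × SignType // p ≠ (1,1) ∧ p ≠ (0,1) ∧ p ≠ (-1,0)}

def pat {n : ℕ} (i : ZMod n) (p : G) : ZMod n → SignType := fun k =>
  if (k - i).val = n - 1 then 0 else if (k - i).val = n - 2 then 1
  else if (k - i).val = n - 3 then p.1.2 else if (k - i).val = n - 4 then p.1.1 else -1

lemma pat_coord {n : ℕ} (i : ZMod n) (p : G) (v : ℕ) (hv : v < n) : pat i p (i + v) =
    if v = n - 1 then 0 else if v = n - 2 then 1
    else if v = n - 3 then p.1.2 else if v = n - 4 then p.1.1 else -1 := by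
  simp [pat, ZMod.val_natCast_of_lt hv]

lemma Rr_run {n : ℕ} {s : ZMod n → SignType} {M : ZMod n → ZMod n → Prop} (h : Rc s M)
    (i j : ZMod n) (m : ℕ) (hl : ∀ t : ℕ, t < m → s (i + t) = -1) :
    Rr s M i j ↔ (∃ u : ℕ, u < m ∧ j = i + u) ∨ Rr s M (i + m) j := by
  induction m with
  | zero => simp
  | succ m ih =>
    rw [ih (fun t ht => hl t (by omega)), Rr_step h (i + m), if_pos (hl m (by omega)), ← or_assoc]
    have : i + (m : ZMod n) + 1 = i + ((m + 1 : ℕ) : ZMod n) := by push_cast; ring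
    rw [this]
    apply or_congr_left
    constructor
    · rintro (⟨u, hu, rfl⟩ | rfl)
      · exact ⟨u, by omega, rfl⟩
      · exact ⟨m, by omega, rfl⟩
    · rintro ⟨u, hu, rfl⟩
      rcases Nat.lt_succ_iff_lt_or_eq.mp hu with hu | rfl
      · exact Or.inl ⟨u, hu, rfl⟩
      · exact Or.inr rfl

/-- full local expansion in coordinates -/
lemma key {n : ℕ} (hn : 8 < n) {s : ZMod n → SignType} {M : ZMod n → ZMod n → Prop} (h : Rc s M)
    (i : ZMod n) (hl : ∀ t : ℕ, t < n - 4 → s (i + t) = -1) (h1 : s (i - 1) = 0) (v : ℕ)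
    (hv : v < n) :
    (M i (i + v) ↔ (v = n - 1 ∨ Rr s M i (i + v))) ∧
    (Rr s M i (i + v) ↔ (v < n - 4 ∨ if s (i - 4) = -1 then (v = n - 4 ∨
      if s (i - 3) = -1 then (v = n - 3 ∨ if s (i - 2) = -1 then (v = n - 2 ∨ v = 0) else v = n - 1)
      else v = n - 2) else v = n - 3)) ∧
    (M (i - 1) (i + v) ↔ (v = 0 ∨ if s (i - 2) = 1 then (v = n - 1 ∨ if s (i - 3) = 1 then
      (v = n - 2 ∨ if s (i - 4) = 1 then (v = n - 3 ∨ v = n - 5) else v = n - 4) else v = n - 3)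
      else v = n - 2)) := by
  have c : ∀ w : ℕ, 1 ≤ w → w < n → (i + (v : ZMod n) = i - (w : ZMod n) ↔ v = n - w) := by
    intro w hw1 hw
    rw [sub_nat _ hw.le, add_right_inj, natcast_inj hv (by omega)]
  have c0 : i + (v : ZMod n) = i ↔ v = 0 := by
    have := natcast_inj (n := n) (a := v) (b := 0) hv (by omega)
    simpa using this
  have c1 := c 1 (by omega) (by omega)
  have c2 := c 2 (by omega) (by omega)
  have c3 := c 3 (by omega) (by omega)
  have c4 := c 4 (by omega) (by omega)
  have c5 := c 5 (by omega) (by omega)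
  push_cast at c1 c2 c3 c4 c5
  have e2 : i - 1 - 1 = i - 2 := by ring
  have e3 : i - 2 - 1 = i - 3 := by ring
  have e4 : i - 3 - 1 = i - 4 := by ring
  have e5 : i - 4 - 1 = i - 5 := by ring
  have f1 : i - 1 + 1 = i := by ring
  have f2 : i - 2 + 1 = i - 1 := by ring
  have f3 : i - 3 + 1 = i - 2 := by ring
  have f4 : i - 4 + 1 = i - 3 := by ring
  have g5 : s (i - 5) = -1 := by
    have := hl (n - 5) (by omega)
    rwa [← sub_nat _ (by omega)] at this
  refine ⟨?_, ?_, ?_⟩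
  · rw [h, Lr, h1, if_neg (by decide), c1]
  · rw [Rr_run h i _ (n - 4) hl, ← sub_nat _ (by omega)]
    push_cast
    rw [Rr_step h, f4, Rr_step h, f3, Rr_step h, f2, Rr_step h (i-1), f1, h1,
      if_neg (show (0 : SignType) ≠ -1 by decide), c0, c1, c2, c3, c4]
    apply or_congr_left
    constructor
    · rintro ⟨u, hu, e⟩
      rw [add_right_inj, natcast_inj hv (by omega)] at e
      omega
    · intro hv; exact ⟨v, hv, rfl⟩
  · rw [h, Rr, h1, if_neg (by decide), f1, Lr_step h, e2, Lr_step h, e3, Lr_step h, e4,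
      Lr_step h (i - 4), e5, g5, if_neg (show (-1 : SignType) ≠ 1 by decide), c0, c1, c2, c3, c4, c5,
      or_comm]

lemma fin1 {n : ℕ} (hn : 8 < n) {s s' : ZMod n → SignType} {M : ZMod n → ZMod n → Prop}
    (h : Rc s M) (h' : Rc s' M) (hv : Valid s) (hm : ∀ q, s q = -1 ↔ s' q = -1)
    (i : ZMod n) (h0 : s (i - 1) = 0) (h1 : s' (i - 1) = 1) : ∃ p : G, s = pat i p := by
  have hl : ∀ t : ℕ, t < n - 4 → s (i + t) = -1 := by
    intro t ht
    by_contra hs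
    exact main1 hn h h' i (by rw [h0]; decide) t ht hs h1
  have hsi : s i = -1 := by simpa using hl 0 (by omega)
  have E : ∀ j, M i j ↔ (M (i - 1) j ∨ Rr s M i j) := by
    intro j
    conv_lhs => rw [h']
    rw [Lr, if_pos h1, Rr, Rr, if_pos hsi, if_pos ((hm i).1 hsi)]
  have K := fun v hv => key hn h i hl h0 v hv
  have E' : ∀ w : ℕ, 1 ≤ w → w ≤ 4 → _ := fun w hw hw' => by
    have k := K (n - w) (by omega)
    have e := E (i + (n - w : ℕ))
    rw [k.1, k.2.1, k.2.2] at e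
    exact e
  have w1 := E' 1 (by omega) (by omega)
  have w2 := E' 2 (by omega) (by omega)
  have w3 := E' 3 (by omega) (by omega)
  have w4 := E' 4 (by omega) (by omega)
  have x12 : n - 1 ≠ n - 2 := by omega
  have x13 : n - 1 ≠ n - 3 := by omega
  have x14 : n - 1 ≠ n - 4 := by omega
  have x15 : n - 1 ≠ n - 5 := by omega
  have x23 : n - 2 ≠ n - 3 := by omega
  have x24 : n - 2 ≠ n - 4 := by omega
  have x25 : n - 2 ≠ n - 5 := by omega
  have x34 : n - 3 ≠ n - 4 := by omega
  have x35 : n - 3 ≠ n - 5 := by omega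
  have x45 : n - 4 ≠ n - 5 := by omega
  have y1 : n - 1 ≠ 0 := by omega
  have y2 : n - 2 ≠ 0 := by omega
  have y3 : n - 3 ≠ 0 := by omega
  have y4 : n - 4 ≠ 0 := by omega
  have z1 : ¬ (n - 1 < n - 4) := by omega
  have z2 : ¬ (n - 2 < n - 4) := by omega
  have z3 : ¬ (n - 3 < n - 4) := by omega
  have z4 : ¬ (n - 4 < n - 4) := by omega
  simp only [x12, x13, x14, x15, x23, x24, x25, x34, x35, x45, x12.symm, x13.symm, x14.symm,
    x23.symm, x24.symm, x34.symm, y1, y2, y3, y4, z1, z2, z3, z4] at w1 w2 w3 w4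
  have hnot : ¬ (s (i - 2) = -1 ∧ s (i - 3) = -1 ∧ s (i - 4) = -1) := by
    rintro ⟨a2, a3, a4⟩
    have : ∀ q, s q ≠ 1 := by
      intro q
      obtain ⟨v, hv, rfl⟩ := exists_coord hn i q
      rcases (by omega : v < n - 4 ∨ v = n - 4 ∨ v = n - 3 ∨ v = n - 2 ∨ v = n - 1) with
        hv | rfl | rfl | rfl | rfl
      · rw [hl v hv]; decide
      all_goals
        rw [← sub_nat _ (by omega)]
        push_cast
      · rw [a4]; decide
      · rw [a3]; decide
      · rw [a2]; decide
      · rw [h0]; decide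
    rcases hv with hv | ⟨⟨a, ha⟩, -⟩
    · rw [hv] at hsi; exact absurd hsi (by decide)
    · exact this a ha
  have fin : s (i - 2) = 1 ∧ ((s (i - 4), s (i - 3)) ≠ (1,1) ∧ (s (i - 4), s (i - 3)) ≠ (0,1) ∧
      (s (i - 4), s (i - 3)) ≠ (-1,0)) := by
    generalize s (i - 4) = a at *
    generalize s (i - 3) = b at *
    generalize s (i - 2) = c at *
    clear E' K E hl hm h h' hv
    clear * - w1 w2 w3 w4 hnot
    simp only [ite_prop_iff_or, and_false, and_true, or_false, false_or, true_or, true_iff]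
      at w1 w2 w3 w4
    have d1 : (1 : SignType) ≠ -1 := by decide
    have d2 : (-1 : SignType) ≠ 1 := by decide
    have d3 : (0 : SignType) ≠ 1 := by decide
    have d4 : (0 : SignType) ≠ -1 := by decide
    have d5 : (1 : SignType) ≠ 0 := by decide
    have d6 : (-1 : SignType) ≠ 0 := by decide
    have tri : ∀ x : SignType, x = 1 ∨ x = 0 ∨ x = -1 := by decide
    rcases tri a with rfl | rfl | rfl <;> rcases tri b with rfl | rfl | rfl <;>
      rcases tri c with rfl | rfl | rfl <;>
      simp [d1, d2, d3, d4, d5, d6] at w1 w2 w3 w4 hnot ⊢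
  refine ⟨⟨(s (i - 4), s (i - 3)), fin.2⟩, ?_⟩
  funext q
  obtain ⟨v, hv, rfl⟩ := exists_coord hn i q
  rw [pat_coord _ _ _ hv]
  rcases (by omega : v < n - 4 ∨ v = n - 4 ∨ v = n - 3 ∨ v = n - 2 ∨ v = n - 1) with
        hv | rfl | rfl | rfl | rfl
  · rw [hl v hv]
    rw [if_neg (by omega), if_neg (by omega), if_neg (by omega), if_neg (by omega)]
  · rw [← sub_nat _ (by omega)]
    simp [x14.symm, x24.symm, x34.symm]
  · rw [← sub_nat _ (by omega)]
    simp [x13.symm, x23.symm]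
  · rw [← sub_nat _ (by omega)]
    simp [x12.symm, fin.1]
  · rw [← sub_nat _ (by omega)]
    simp [h0]

lemma fin2 {n : ℕ} (hn : 8 < n) {s s' : ZMod n → SignType} {M : ZMod n → ZMod n → Prop}
    (h : Rc s M) (h' : Rc s' M) (hv : Valid s) (hv' : Valid s') (hm : ∀ q, s q = -1 ↔ s' q = -1)
    (hne : s ≠ s') : ∃ i, ∃ p : G, s = pat i p ∨ s' = pat i p := by
  obtain ⟨q, hq⟩ := Function.ne_iff.mp hne
  have key3 : ∀ x y : SignType, x ≠ y → (x = -1 ↔ y = -1) → (x = 0 ∧ y = 1) ∨ (y = 0 ∧ x = 1) := by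
    decide
  have e : q = (q + 1) - 1 := by ring
  rcases key3 _ _ hq (hm q) with ⟨a, b⟩ | ⟨a, b⟩
  · rw [e] at a b
    obtain ⟨p, hp⟩ := fin1 hn h h' hv hm _ a b
    exact ⟨_, p, Or.inl hp⟩
  · rw [e] at a b
    obtain ⟨p, hp⟩ := fin1 hn h' h hv' (fun q => (hm q).symm) _ a b
    exact ⟨_, p, Or.inr hp⟩

def bad {n : ℕ} (x : Bool × ZMod n × G) : ZMod n → SignType :=
  if x.1 then pat x.2.1 x.2.2 else rf (pat x.2.1 x.2.2)

lemma inj {n : ℕ} (hn : 8 < n) {s s' : ZMod n → SignType} {M : ZMod n → ZMod n → Prop}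
    (h : Rc s M) (h' : Rc s' M) (hv : Valid s) (hv' : Valid s')
    (hb : s ∉ Set.range (bad (n := n))) (hb' : s' ∉ Set.range (bad (n := n))) : s = s' := by
  by_contra hne
  by_cases hp : ∀ q, s q = 1 ↔ s' q = 1
  · obtain ⟨i, p, hip⟩ := fin2 hn (Rc_rf h) (Rc_rf h') (Valid_rf hv) (Valid_rf hv')
      (fun q => by simp [rf, hp]) (fun e => hne (by
        rw [← rf_rf s, e, rf_rf]))
    rcases hip with hip | hip
    · exact hb ⟨(false, i, p), by simp [bad, ← hip, rf_rf]⟩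
    · exact hb' ⟨(false, i, p), by simp [bad, ← hip, rf_rf]⟩
  · have n1 : ∀ q, ∃ t : ℕ, t < n - 4 ∧ s (q - 1 - t) ≠ 1 := by
      intro q
      by_contra hc
      push Not at hc
      exact hp (half' hn h h' hv q hc)
    have n2 : ∀ q, ∃ t : ℕ, t < n - 4 ∧ s' (q - 1 - t) ≠ 1 := by
      intro q
      by_contra hc
      push Not at hc
      exact hp (fun k => (half' hn h' h hv' q hc k).symm)
    have hm : ∀ q, s q = -1 ↔ s' q = -1 := by
      intro q
      obtain ⟨t, ht, ht'⟩ := n1 q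
      obtain ⟨u, hu, hu'⟩ := n2 q
      constructor
      · intro hq
        by_contra hq'
        exact main2 hn h' h q hq' u hu hu' hq
      · intro hq
        by_contra hq'
        exact main2 hn h h' q hq' t ht ht' hq
    obtain ⟨i, p, hip⟩ := fin2 hn h h' hv hv' hm hne
    rcases hip with hip | hip
    · exact hb ⟨(true, i, p), by simp [bad, ← hip]⟩
    · exact hb' ⟨(true, i, p), by simp [bad, ← hip]⟩

lemma start_unique {n : ℕ} (hn : 8 < n) {s : ZMod n → SignType} {i i' : ZMod n}
    (hl : ∀ t : ℕ, t < n - 4 → s (i + t) = -1) (h1 : s (i - 1) ≠ -1)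
    (hl' : ∀ t : ℕ, t < n - 4 → s (i' + t) = -1) (h1' : s (i' - 1) ≠ -1) : i = i' := by
  obtain ⟨w, hw, rfl⟩ := exists_coord hn i i'
  rcases (by omega : w = 0 ∨ (1 ≤ w ∧ w ≤ n - 4) ∨ n - 4 < w) with rfl | ⟨a, b⟩ | a
  · simp
  · exfalso
    apply h1'
    rw [← hl (w - 1) (by omega), Nat.cast_sub a]
    congr 1; push_cast; ring
  · exfalso
    apply h1
    rw [← hl' (n - w - 1) (by omega), Nat.cast_sub (by omega), Nat.cast_sub hw.le]
    congr 1; simp; ring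

lemma pat_run {n : ℕ} (hn : 8 < n) (i : ZMod n) (p : G) (t : ℕ) (ht : t < n - 4) :
    pat i p (i + t) = -1 := by
  rw [pat_coord _ _ _ (by omega), if_neg (by omega), if_neg (by omega), if_neg (by omega),
    if_neg (by omega)]

lemma pat_sub {n : ℕ} (hn : 8 < n) (i : ZMod n) (p : G) : pat i p (i - 1) = 0 ∧
    pat i p (i - 2) = 1 ∧ pat i p (i - 3) = p.1.2 ∧ pat i p (i - 4) = p.1.1 := by
  have e : ∀ w : ℕ, 1 ≤ w → w < n → pat i p (i - w) = _ := fun w hw hw' => by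
    rw [sub_nat _ hw'.le, pat_coord _ _ _ (by omega)]
  have e1 := e 1 (by omega) (by omega)
  have e2 := e 2 (by omega) (by omega)
  have e3 := e 3 (by omega) (by omega)
  have e4 := e 4 (by omega) (by omega)
  rw [if_pos rfl] at e1
  rw [if_neg (by omega), if_pos rfl] at e2
  rw [if_neg (by omega), if_neg (by omega), if_pos rfl] at e3
  rw [if_neg (by omega), if_neg (by omega), if_neg (by omega), if_pos rfl] at e4
  push_cast at e1 e2 e3 e4
  exact ⟨e1, e2, e3, e4⟩

/-- a labelling with a long minus run is not a reflected pattern -/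
lemma ne_rf {n : ℕ} (hn : 8 < n) {s : ZMod n → SignType} {i : ZMod n}
    (hl : ∀ t : ℕ, t < n - 4 → s (i + t) = -1) (i' : ZMod n) (p : G) : s ≠ rf (pat i' p) := by
  rintro rfl
  obtain ⟨t, u, ht, hu, e⟩ := arcs' hn i (-1 - i')
  have h1 := hl t ht
  rw [e, rf, neg_eq_neg_one] at h1
  have h2 := pat_run hn i' p u hu
  have e3 : -1 - (-1 - i' - (u : ZMod n)) = i' + u := by ring
  rw [e3, h2] at h1
  exact absurd h1 (by decide)

lemma pat_inj {n : ℕ} (hn : 8 < n) {i i' : ZMod n} {p p' : G} (h : pat i p = pat i' p') :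
    i = i' ∧ p = p' := by
  have h0 := pat_sub hn i p
  have h0' := pat_sub hn i' p'
  have hi : i = i' := start_unique hn (s := pat i p) (pat_run hn i p) (by rw [h0.1]; decide)
    (by rw [h]; exact pat_run hn i' p') (by rw [h, h0'.1]; decide)
  subst hi
  refine ⟨rfl, ?_⟩
  apply Subtype.ext
  apply Prod.ext
  · rw [← h0.2.2.2, ← h0'.2.2.2, h]
  · rw [← h0.2.2.1, ← h0'.2.2.1, h]

lemma bad_inj {n : ℕ} (hn : 8 < n) : Function.Injective (bad (n := n)) := by
  rintro ⟨b, i, p⟩ ⟨b', i', p'⟩ h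
  cases b <;> cases b' <;> simp only [bad, if_true, Bool.false_eq_true, if_false] at h
  · have := congrArg rf h
    rw [rf_rf, rf_rf] at this
    obtain ⟨rfl, rfl⟩ := pat_inj hn this
    rfl
  · exact absurd h.symm (ne_rf hn (pat_run hn i' p') _ _)
  · exact absurd h (ne_rf hn (pat_run hn i p) _ _)
  · obtain ⟨rfl, rfl⟩ := pat_inj hn h
    rfl

lemma pat_valid {n : ℕ} (hn : 8 < n) (i : ZMod n) (p : G) : Valid (pat i p) :=
  Or.inr ⟨⟨_, (pat_sub hn i p).2.1⟩, ⟨_, pat_run hn i p 0 (by omega)⟩⟩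

lemma bad_valid {n : ℕ} (hn : 8 < n) (x) : Valid (bad (n := n) x) := by
  rcases x with ⟨b, i, p⟩
  cases b
  · exact Valid_rf (pat_valid hn i p)
  · exact pat_valid hn i p

lemma merge {n : ℕ} (hn : 8 < n) (i : ZMod n) (p : G) {M : ZMod n → ZMod n → Prop}
    (h : Rc (pat i p) M) : Rc (Function.update (pat i p) (i - 1) 1) M := by
  intro k j
  have hP := pat_sub hn i p
  by_cases hk : k = i
  · subst hk
    obtain ⟨v, hv, rfl⟩ := exists_coord hn k j
    have hne : k ≠ k - 1 := by
      intro e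
      have : ((1 : ℕ) : ZMod n) = (0 : ℕ) := by
        push_cast
        calc (1 : ZMod n) = k - (k - 1) := by ring
          _ = 0 := by rw [← e]; ring
      rw [natcast_inj (by omega) (by omega)] at this
      omega
    have hR : Rr (Function.update (pat k p) (k - 1) 1) M k (k + v) = Rr (pat k p) M k (k + v) := by
      rw [Rr, Rr, Function.update_of_ne hne]
    rw [hR, Lr, Function.update_self, if_pos rfl]
    obtain ⟨k1, k2, k3⟩ := key hn h k (pat_run hn k p) hP.1 v hv
    rw [k1, k2, k3, hP.2.1, hP.2.2.1, hP.2.2.2]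
    obtain ⟨⟨a, b⟩, hp⟩ := p
    have tri : ∀ a b : SignType, ((a, b) ≠ (1,1) ∧ (a, b) ≠ (0,1) ∧ (a, b) ≠ (-1,0)) →
      (a ≠ -1 ∧ b ≠ 1) ∨ (a = -1 ∧ b = -1) ∨ (a = -1 ∧ b = 1) := by decide
    have d1 : (1 : SignType) ≠ -1 := by decide
    have d2 : (-1 : SignType) ≠ 1 := by decide
    rcases tri a b hp with ⟨ha, hb⟩ | ⟨rfl, rfl⟩ | ⟨rfl, rfl⟩
    · simp only [ha, hb, if_true, if_false]
      omega
    · simp only [d1, d2, if_true, if_false]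
      omega
    · simp only [d1, d2, if_true, if_false]
      omega
  · have hk1 : k - 1 ≠ i - 1 := fun e => hk (by simpa using e)
    rw [h, Lr, Lr, Rr, Rr, Function.update_of_ne hk1]
    by_cases hk2 : k = i - 1
    · subst hk2
      rw [Function.update_self, hP.1, if_neg (show (0 : SignType) ≠ -1 by decide),
        if_neg (show (1 : SignType) ≠ -1 by decide)]
    · rw [Function.update_of_ne hk2]

lemma nat_ne {n : ℕ} (hn : 8 < n) (i : ZMod n) (t : ℕ) (ht : t < n - 1) : i + t ≠ i - 1 := by
  intro e
  have := sub_nat i (c := 1) (n := n) (by omega)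
  push_cast at this
  rw [this, add_right_inj, natcast_inj (by omega) (by omega)] at e
  omega

lemma upd_run {n : ℕ} (hn : 8 < n) (i : ZMod n) (p : G) (t : ℕ) (ht : t < n - 4) :
    Function.update (pat i p) (i - 1) 1 (i + t) = -1 := by
  rw [Function.update_of_ne (nat_ne hn i t (by omega)), pat_run hn i p t ht]

lemma upd_not_bad {n : ℕ} (hn : 8 < n) (i : ZMod n) (p : G) (x) :
    bad x ≠ Function.update (pat i p) (i - 1) 1 := by
  rcases x with ⟨b, i', p'⟩
  cases b <;> simp only [bad, if_true, Bool.false_eq_true, if_false]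
  · exact (ne_rf hn (upd_run hn i p) i' p').symm
  · intro h
    have h0 := (pat_sub hn i' p').1
    have hi : i = i' := start_unique hn (upd_run hn i p) (by rw [Function.update_self]; decide)
      (by rw [← h]; exact pat_run hn i' p') (by rw [← h, h0]; decide)
    subst hi
    rw [h, Function.update_self] at h0
    exact absurd h0 (by decide)

lemma upd_valid {n : ℕ} (hn : 8 < n) (i : ZMod n) (p : G) :
    Valid (Function.update (pat i p) (i - 1) 1) :=
  Or.inr ⟨⟨i - 1, Function.update_self ..⟩, ⟨_, upd_run hn i p 0 (by omega)⟩⟩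

lemma bad_merge {n : ℕ} (hn : 8 < n) (x : Bool × ZMod n × G) :
    ∃ s', Valid s' ∧ s' ∉ Set.range (bad (n := n)) ∧ ∀ M, Rc (bad x) M → Rc s' M := by
  rcases x with ⟨b, i, p⟩
  cases b
  · refine ⟨rf (Function.update (pat i p) (i - 1) 1), Valid_rf (upd_valid hn i p), ?_, ?_⟩
    · rintro ⟨⟨b, i', p'⟩, hx⟩
      refine upd_not_bad hn i p (!b, i', p') ?_
      rw [← rf_rf (Function.update (pat i p) (i - 1) 1), ← hx]
      cases b <;> simp [bad, rf_rf]
    · intro M hM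
      have h1 := Rc_rf hM
      simp only [bad, Bool.false_eq_true, if_false, rf_rf] at h1
      have := Rc_rf (merge hn i p h1)
      rwa [rfM_rfM] at this
  · exact ⟨_, upd_valid hn i p, fun ⟨x, hx⟩ => upd_not_bad hn i p x hx, fun M hM => merge hn i p hM⟩

lemma card_bad {n : ℕ} (hn : 8 < n) : (Set.range (bad (n := n))).ncard = 12 * n := by
  have : NeZero n := ⟨by omega⟩
  rw [← Set.image_univ, Set.ncard_image_of_injective _ (bad_inj hn), Set.ncard_univ,
    Nat.card_eq_fintype_card, Fintype.card_prod, Fintype.card_prod, ZMod.card,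
    show Fintype.card G = 6 by decide, Fintype.card_bool]
  ring

lemma card_valid {n : ℕ} (hn : 8 < n) :
    {s : ZMod n → SignType | Valid s}.ncard + 2 ^ (n + 1) = 3 ^ n + 2 := by
  classical
  have : NeZero n := ⟨by omega⟩
  let A : Finset (ZMod n → SignType) := Fintype.piFinset (fun _ => {0, 1})
  let B : Finset (ZMod n → SignType) := Fintype.piFinset (fun _ => {0, -1})
  have hA : A.card = 2 ^ n := by
    simp [A, Fintype.card_piFinset, ZMod.card, show ({0, 1} : Finset SignType).card = 2 by decide]
  have hB : B.card = 2 ^ n := by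
    simp [B, Fintype.card_piFinset, ZMod.card, show ({0, -1} : Finset SignType).card = 2 by decide]
  have hAB : A ∩ B = {fun _ => 0} := by
    ext s
    simp only [A, B, Finset.mem_inter, Fintype.mem_piFinset, Finset.mem_singleton]
    have t : ∀ x : SignType, x ∈ ({0, 1} : Finset SignType) → x ∈ ({0, -1} : Finset SignType) →
      x = 0 := by decide
    constructor
    · rintro ⟨h1, h2⟩
      funext k
      exact t _ (h1 k) (h2 k)
    · rintro rfl
      simp
  have hV : {s : ZMod n → SignType | Valid s} =
      ((insert (fun _ => 0) (A ∪ B)ᶜ : Finset (ZMod n → SignType)) : Set (ZMod n → SignType)) := by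
    ext s
    simp only [Set.mem_ofPred_eq, Finset.coe_insert, Set.mem_insert_iff, Finset.mem_coe,
      Finset.mem_compl, Finset.mem_union, A, B, Fintype.mem_piFinset, Valid]
    have t1 : ∀ x : SignType, x ∈ ({0, 1} : Finset SignType) ↔ x ≠ -1 := by decide
    have t2 : ∀ x : SignType, x ∈ ({0, -1} : Finset SignType) ↔ x ≠ 1 := by decide
    simp only [t1, t2, funext_iff]
    push Not
    tauto
  have hc := Finset.card_union_add_card_inter A B
  have hz : (fun _ => 0 : ZMod n → SignType) ∉ (A ∪ B)ᶜ := by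
    simp [A]
  have hcc := Finset.card_compl_add_card (A ∪ B)
  rw [Fintype.card_fun, ZMod.card, show Fintype.card SignType = 3 by decide] at hcc
  rw [hV, Set.ncard_coe_finset, Finset.card_insert_of_notMem hz]
  rw [hAB, hA, hB, Finset.card_singleton] at hc
  rw [pow_succ]
  omega

/-- labelling of a schedule -/
noncomputable def sg {n : ℕ} (τ : ZMod n → ℕ) : ZMod n → SignType :=
  fun k => SignType.sign ((τ (k + 1) : ℤ) - τ k)

lemma sg_one {n : ℕ} (τ : ZMod n → ℕ) (k : ZMod n) : sg τ k = 1 ↔ τ k < τ (k + 1) := by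
  rw [sg, sign_eq_one_iff]; omega

lemma sg_neg {n : ℕ} (τ : ZMod n → ℕ) (k : ZMod n) : sg τ k = -1 ↔ τ (k + 1) < τ k := by
  rw [sg, sign_eq_neg_one_iff]; omega

lemma sg_valid {n : ℕ} (hn : 8 < n) (τ : ZMod n → ℕ) : Valid (sg τ) := by
  have : NeZero n := ⟨by omega⟩
  have hsum : ∑ k : ZMod n, ((τ (k + 1) : ℤ) - τ k) = 0 := by
    rw [Finset.sum_sub_distrib, sub_eq_zero]
    exact Equiv.sum_comp (Equiv.addRight (1 : ZMod n)) (fun k => (τ k : ℤ))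
  by_cases h1 : ∃ k, sg τ k = 1
  · by_cases h2 : ∃ k, sg τ k = -1
    · exact Or.inr ⟨h1, h2⟩
    · left
      push Not at h2
      have h3 : ∀ k ∈ Finset.univ, 0 ≤ ((τ (k + 1) : ℤ) - τ k) := fun k _ => by
        have := h2 k
        rw [Ne, sg_neg] at this; omega
      intro k
      rw [sg, (Finset.sum_eq_zero_iff_of_nonneg h3).1 hsum k (Finset.mem_univ _), sign_zero]
  · left
    push Not at h1
    have h3 : ∀ k ∈ Finset.univ, ((τ (k + 1) : ℤ) - τ k) ≤ 0 := fun k _ => by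
      have := h1 k
      rw [Ne, sg_one] at this; omega
    intro k
    rw [sg, (Finset.sum_eq_zero_iff_of_nonpos h3).1 hsum k (Finset.mem_univ _), sign_zero]

lemma exists_pot {n : ℕ} [NeZero n] (w : ZMod n → ℤ) (hw : ∑ k, w k = 0) :
    ∃ P : ZMod n → ℤ, ∀ k, P (k + 1) - P k = w k := by
  have hw' : ∑ m ∈ Finset.range n, w (m : ZMod n) = 0 := by
    rw [← hw]
    refine Finset.sum_bij (fun m _ => (m : ZMod n)) (fun _ _ => Finset.mem_univ _) ?_ ?_
      (fun _ _ => rfl)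
    · intro a ha b hb h
      exact (natcast_inj (Finset.mem_range.1 ha) (Finset.mem_range.1 hb)).1 h
    · intro b _
      exact ⟨b.val, Finset.mem_range.2 (ZMod.val_lt b), by simp⟩
  refine ⟨fun k => ∑ m ∈ Finset.range k.val, w (m : ZMod n), fun k => ?_⟩
  have hk := ZMod.val_lt k
  have hkk : ((k.val : ℕ) : ZMod n) = k := by simp
  by_cases h : k.val + 1 < n
  · have : (k + 1).val = k.val + 1 := by
      conv_lhs => rw [← hkk]
      rw [← Nat.cast_one, ← Nat.cast_add, ZMod.val_natCast_of_lt h]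
    simp only [this, Finset.sum_range_succ, hkk]
    ring
  · have h' : k.val + 1 = n := by omega
    have : (k + 1) = 0 := by
      conv_lhs => rw [← hkk]
      rw [← Nat.cast_one, ← Nat.cast_add, h']; simp
    have hw'' : ∑ m ∈ Finset.range (k.val + 1), w (m : ZMod n) = 0 := by
      rw [show Finset.range (k.val + 1) = Finset.range n by rw [h']]; exact hw'
    rw [Finset.sum_range_succ, hkk] at hw''
    simp only [this, ZMod.val_zero, Finset.range_zero, Finset.sum_empty]
    linarith

lemma exists_sched {n : ℕ} (hn : 8 < n) (s : ZMod n → SignType) (hv : Valid s) :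
    ∃ τ, sg τ = s := by
  classical
  have : NeZero n := ⟨by omega⟩
  rcases hv with hv | ⟨⟨a, ha⟩, ⟨b, hb⟩⟩
  · exact ⟨fun _ => 0, by funext k; simp [sg, hv]⟩
  let p : ℕ := (Finset.univ.filter (fun k => s k = 1)).card
  let q : ℕ := (Finset.univ.filter (fun k => s k = -1)).card
  have hp : 0 < p := Finset.card_pos.2 ⟨a, by simp [ha]⟩
  have hq : 0 < q := Finset.card_pos.2 ⟨b, by simp [hb]⟩
  let w : ZMod n → ℤ := fun k => (if s k = 1 then (q : ℤ) else 0) + (if s k = -1 then -(p : ℤ) else 0)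
  have hw : ∑ k, w k = 0 := by
    simp only [w, Finset.sum_add_distrib, ← Finset.sum_filter, Finset.sum_const, nsmul_eq_mul]
    change (p : ℤ) * q + q * -p = 0
    ring
  obtain ⟨P, hP⟩ := exists_pot w hw
  obtain ⟨m, hm⟩ : ∃ m, ∀ k, P m ≤ P k := Finite.exists_min P
  refine ⟨fun k => (P k - P m).toNat, ?_⟩
  funext k
  have e : (((P (k + 1) - P m).toNat : ℕ) : ℤ) - ((P k - P m).toNat : ℕ) = w k := by
    rw [Int.toNat_of_nonneg (by linarith [hm (k+1)]), Int.toNat_of_nonneg (by linarith [hm k]), ← hP]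
    ring
  simp only [sg, e, w]
  have tri : ∀ x : SignType, x = 1 ∨ x = 0 ∨ x = -1 := by decide
  rcases tri (s k) with h | h | h
  · rw [h, if_pos rfl, if_neg (by decide), add_zero]
    exact sign_pos (by exact_mod_cast hq)
  · rw [h, if_neg (by decide), if_neg (by decide), add_zero, sign_zero]
  · rw [h, if_neg (by decide), if_pos rfl, zero_add]
    exact sign_neg (by simpa using hp)

abbrev h160 : Bool → Bool → Bool → Bool := fun a _ c => a && c

lemma upTo_eq {n : ℕ} (h : Bool → Bool → Bool → Bool) (τ : ZMod n → ℕ) (x : ZMod n → Bool)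
    (k : ℕ) (i : ZMod n) :
    ecaUpTo n h τ k x i = if τ i ≤ k then ecaAsync n h τ x i else x i := by
  induction k with
  | zero =>
    by_cases hi : τ i = 0
    · simp [ecaAsync, hi]
    · simp [ecaUpTo, ecaStep, hi]
  | succ k ih =>
    by_cases hi : τ i = k + 1
    · simp [ecaAsync, hi]
    · simp only [ecaUpTo, ecaStep, if_neg hi, ih]
      congr 1
      rw [eq_iff_iff]; omega

lemma async_rec {n : ℕ} (h : Bool → Bool → Bool → Bool) (τ : ZMod n → ℕ) (x : ZMod n → Bool)
    (i : ZMod n) : ecaAsync n h τ x i =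
      h (if τ (i - 1) < τ i then ecaAsync n h τ x (i - 1) else x (i - 1)) (x i)
        (if τ (i + 1) < τ i then ecaAsync n h τ x (i + 1) else x (i + 1)) := by
  conv_lhs => rw [ecaAsync]
  rcases hk : τ i with _ | k
  · simp [ecaUpTo, ecaStep, hk]
  · simp only [ecaUpTo, ecaStep, hk, if_true, upTo_eq, Nat.lt_succ_iff]
    simp

def D {n : ℕ} (τ : ZMod n → ℕ) (i j : ZMod n) : Prop :=
  ecaAsync n h160 τ (fun k => decide (k ≠ j)) i = false

lemma D_rc {n : ℕ} (τ : ZMod n → ℕ) : Rc (sg τ) (D τ) := by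
  intro i j
  unfold Lr Rr
  simp only [sg_one, sg_neg, sub_add_cancel]
  conv_lhs => rw [D, async_rec]
  simp only [h160, Bool.and_eq_false_iff]
  apply or_congr
  · split_ifs
    · rfl
    · rw [decide_eq_false_iff_not, not_not, eq_comm]
  · split_ifs
    · rfl
    · rw [decide_eq_false_iff_not, not_not, eq_comm]

lemma Rc_unique {n : ℕ} (τ : ZMod n → ℕ) {M M' : ZMod n → ZMod n → Prop} (h : Rc (sg τ) M)
    (h' : Rc (sg τ) M') : M = M' := by
  have : ∀ (m : ℕ) (i : ZMod n), τ i = m → ∀ j, M i j ↔ M' i j := by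
    intro m
    induction m using Nat.strong_induction_on with
    | _ m ih =>
      intro i hi j
      rw [h, h', Lr, Rr, Lr, Rr]
      simp only [sg_one, sg_neg, sub_add_cancel]
      apply or_congr
      · split_ifs with hc
        · exact ih _ (hi ▸ hc) _ rfl j
        · rfl
      · split_ifs with hc
        · exact ih _ (hi ▸ hc) _ rfl j
        · rfl
  funext i j
  exact propext (this _ i rfl j)

lemma async_iff {n : ℕ} (τ : ZMod n → ℕ) (x : ZMod n → Bool) (i : ZMod n) :
    ecaAsync n h160 τ x i = true ↔ ∀ j, D τ i j → x j = true := by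
  have : ∀ (m : ℕ) (i : ZMod n), τ i = m →
      (ecaAsync n h160 τ x i = true ↔ ∀ j, D τ i j → x j = true) := by
    intro m
    induction m using Nat.strong_induction_on with
    | _ m ih =>
      intro i hi
      have hD : ∀ j, _ := fun j => D_rc τ i j
      simp only [hD, Lr, Rr, sg_one, sg_neg, sub_add_cancel, or_imp, forall_and]
      rw [async_rec]
      simp only [h160, Bool.and_eq_true]
      apply and_congr
      · split_ifs with hc
        · exact ih _ (hi ▸ hc) _ rfl
        · simp
      · split_ifs with hc
        · exact ih _ (hi ▸ hc) _ rfl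
        · simp
  exact this _ i rfl

lemma async_eq_of_D {n : ℕ} {τ τ' : ZMod n → ℕ} (h : D τ = D τ') :
    ecaAsync n h160 τ = ecaAsync n h160 τ' := by
  funext x i
  rw [Bool.eq_iff_iff, async_iff, async_iff, h]

lemma D_of_async {n : ℕ} {τ τ' : ZMod n → ℕ} (h : ecaAsync n h160 τ = ecaAsync n h160 τ') :
    D τ = D τ' := by
  funext i j
  rw [D, D, h]

lemma arith (n : ℕ) (hn : 8 < n) : 2 ^ (n + 1) + 12 * n ≤ 3 ^ n := by
  induction n, hn using Nat.le_induction with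
  | base => norm_num
  | succ m hm ih => rw [pow_succ 2 (m+1), pow_succ 3 m]; omega

end R160

/-- Rule 160 (h a b c = a ∧ c): the number of distinct asynchronous global
functions equals $3^n - 2^{n+1} - 12n + 2$. -/
theorem rule_160_count (n : ℕ) (hn : 8 < n) :
    {g | ∃ τ : ZMod n → ℕ, g = ecaAsync n (fun a _ c => a && c) τ}.ncard
      = 3 ^ n - 2 ^ (n + 1) - 12 * n + 2 := by
  have : NeZero n := ⟨by omega⟩
  choose! T hT using R160.exists_sched (n := n) hn
  have hset : {g | ∃ τ : ZMod n → ℕ, g = ecaAsync n (fun a _ c => a && c) τ} =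
      (fun s => ecaAsync n R160.h160 (T s)) ''
        ({s | R160.Valid s} \ Set.range (R160.bad (n := n))) := by
    ext g
    constructor
    · rintro ⟨τ, rfl⟩
      have hv := R160.sg_valid hn τ
      have hex : ∃ s', R160.Valid s' ∧ s' ∉ Set.range (R160.bad (n := n)) ∧
          R160.Rc s' (R160.D τ) := by
        by_cases hb : R160.sg τ ∈ Set.range (R160.bad (n := n))
        · obtain ⟨x, hx⟩ := hb
          obtain ⟨s', h1, h2, h3⟩ := R160.bad_merge hn x
          exact ⟨s', h1, h2, h3 _ (hx ▸ R160.D_rc τ)⟩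
        · exact ⟨_, hv, hb, R160.D_rc τ⟩
      obtain ⟨s', h1, h2, h3⟩ := hex
      refine ⟨s', ⟨h1, h2⟩, ?_⟩
      apply R160.async_eq_of_D
      have h4 := R160.D_rc (T s')
      refine R160.Rc_unique (T s') h4 ?_
      rw [hT s' h1]; exact h3
    · rintro ⟨s, -, rfl⟩
      exact ⟨T s, rfl⟩
  rw [hset, Set.ncard_image_of_injOn, Set.ncard_sdiff, R160.card_bad hn]
  · have h1 := R160.card_valid hn
    have h2 := R160.arith n hn
    omega
  · rintro _ ⟨x, rfl⟩
    exact R160.bad_valid hn x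
  · rintro s ⟨h1, h2⟩ s' ⟨h1', h2'⟩ h
    have hD := R160.D_of_async h
    have a := R160.D_rc (T s)
    have b := R160.D_rc (T s')
    rw [hT s h1] at a
    rw [hT s' h1', ← hD] at b
    exact R160.inj hn a b h1 h1' h2 h2'
end
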